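/- arXiv:2404.10504 — 13 statements merged into one kernel-verified Lean document; each statement's English description precedes it below -/
import Mathlib

section
/- Let f : (0,∞) → (0,∞) be twice continuously differentiable and solve the profile ODE (P). Define, for η ∈ ℝ and ξ = e^η, X(η) = (α/m) ξ² f(ξ)^{1-m}, Y(η) = ξ f'(ξ)/f(ξ), Z(η) = (1/m) ξ^{σ+2} f(ξ)^{p-m}. Then (X,Y,Z) is differentiable on ℝ and satisfies the autonomous system (S). -/
/-- If `f : (0,∞) → (0,∞)` is twice continuously differentiable and solves the
profile ODE (P), then the functions `X, Y, Z` obtained through the change of variables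
`ξ = e^η`, `X(η) = (α/m) ξ² f(ξ)^{1-m}`, `Y(η) = ξ f'(ξ)/f(ξ)`, `Z(η) = (1/m) ξ^{σ+2} f(ξ)^{p-m}`
are differentiable on `ℝ` and solve the autonomous system (S). -/
theorem stmt_0
    (N : ℕ) (hN : 3 ≤ N)
    (m σ p L α β : ℝ)
    (hm : 1 < m) (hσ : -2 < σ) (hp : m < p)
    (hL : L = σ * (m - 1) + 2 * (p - 1))
    (hα : α = (σ + 2) / L) (hβ : β = (p - m) / L)
    (f : ℝ → ℝ)
    (hfpos : ∀ ξ ∈ Set.Ioi (0 : ℝ), 0 < f ξ)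
    (hreg : ContDiffOn ℝ 2 f (Set.Ioi 0))
    (hODE : ∀ ξ ∈ Set.Ioi (0 : ℝ),
      deriv (deriv (fun t => f t ^ m)) ξ
        + (((N : ℝ) - 1) / ξ) * deriv (fun t => f t ^ m) ξ
        - α * f ξ - β * ξ * deriv f ξ + ξ ^ σ * f ξ ^ p = 0)
    (X Y Z : ℝ → ℝ)
    (hX : X = fun η => α / m * Real.exp η ^ 2 * f (Real.exp η) ^ (1 - m))
    (hY : Y = fun η => Real.exp η * deriv f (Real.exp η) / f (Real.exp η))
    (hZ : Z = fun η => 1 / m * Real.exp η ^ (σ + 2) * f (Real.exp η) ^ (p - m)) :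
    ∀ η : ℝ,
      HasDerivAt X (X η * (2 - (m - 1) * Y η)) η ∧
      HasDerivAt Y (X η - ((N : ℝ) - 2) * Y η - Z η - m * Y η ^ 2
        + (p - m) / (σ + 2) * (X η * Y η)) η ∧
      HasDerivAt Z (Z η * (σ + 2 + (p - m) * Y η)) η := by
  intro η
  have hLpos : 0 < L := by rw [hL]; nlinarith
  have hσ2 : σ + 2 ≠ 0 := by linarith
  have hm0 : m ≠ 0 := by linarith
  have hf1 : ∀ x : ℝ, 0 < x → HasDerivAt f (deriv f x) x := fun x hx =>
    ((hreg.contDiffAt (Ioi_mem_nhds hx)).differentiableAt (by norm_num)).hasDerivAt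
  have hf2 : ∀ x : ℝ, 0 < x → HasDerivAt (deriv f) (deriv (deriv f) x) x := by
    intro x hx
    have h : ContDiffOn ℝ 1 (deriv f) (Set.Ioi 0) :=
      hreg.deriv_of_isOpen isOpen_Ioi (by norm_num)
    exact ((h.contDiffAt (Ioi_mem_nhds hx)).differentiableAt (by norm_num)).hasDerivAt
  have hg1 : ∀ x : ℝ, 0 < x →
      HasDerivAt (fun t => f t ^ m) (deriv f x * m * f x ^ (m - 1)) x := fun x hx =>
    (hf1 x hx).rpow_const (Or.inl (hfpos x hx).ne')
  obtain ⟨ξ, hξ⟩ : ∃ ξ, ξ = Real.exp η := ⟨_, rfl⟩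
  have hξ0 : 0 < ξ := hξ ▸ Real.exp_pos η
  have hF0 := hfpos ξ hξ0
  have hg2 : deriv (deriv (fun t => f t ^ m)) ξ
      = deriv (deriv f) ξ * m * f ξ ^ (m - 1)
        + deriv f ξ * m * (deriv f ξ * (m - 1) * f ξ ^ (m - 1 - 1)) := by
    have he : deriv (fun t => f t ^ m) =ᶠ[nhds ξ] fun x => deriv f x * m * f x ^ (m - 1) := by
      filter_upwards [Ioi_mem_nhds hξ0] with x hx using (hg1 x hx).deriv
    rw [he.deriv_eq]
    exact (((hf2 ξ hξ0).mul_const m).mul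
      ((hf1 ξ hξ0).rpow_const (p := m - 1) (Or.inl hF0.ne'))).deriv
  have hO := hODE ξ hξ0
  rw [hg2, (hg1 ξ hξ0).deriv] at hO
  have hexp : HasDerivAt Real.exp ξ η := hξ ▸ Real.hasDerivAt_exp η
  have hfe : HasDerivAt (fun t => f (Real.exp t)) (deriv f ξ * ξ) η :=
    HasDerivAt.comp η (hξ ▸ hf1 ξ hξ0) hexp
  have hfe2 : HasDerivAt (fun t => deriv f (Real.exp t)) (deriv (deriv f) ξ * ξ) η :=
    HasDerivAt.comp (h₂ := deriv f) η (hξ ▸ hf2 ξ hξ0) hexp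
  have hne : f (Real.exp η) ≠ 0 := hξ ▸ hF0.ne'
  have hA : 0 < f ξ ^ m := Real.rpow_pos_of_pos hF0 _
  have e1 : f ξ ^ (m - 1) = f ξ ^ m / f ξ := Real.rpow_sub_one hF0.ne' _
  have e2 : f ξ ^ (m - 1 - 1) = f ξ ^ m / f ξ / f ξ := by
    rw [Real.rpow_sub_one hF0.ne', e1]
  have e3 : f ξ ^ (1 - m) = f ξ / f ξ ^ m := by rw [Real.rpow_sub hF0, Real.rpow_one]
  have e4 : f ξ ^ (p - m) = f ξ ^ p / f ξ ^ m := Real.rpow_sub hF0 _ _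
  have e5 : ξ ^ (σ + 2) = ξ ^ σ * ξ ^ 2 := by
    rw [Real.rpow_add hξ0]; norm_num
  rw [e1, e2] at hO
  have hF' := hF0.ne'
  have hA' := hA.ne'
  have hξ' := hξ0.ne'
  have hL' := hLpos.ne'
  refine ⟨?_, ?_, ?_⟩
  · have h := ((hexp.pow 2).const_mul (α / m)).mul (hfe.rpow_const (p := 1 - m) (Or.inl hne))
    rw [hX, hY]
    refine h.congr_deriv ?_
    simp only [Pi.pow_apply, ← hξ]
    rw [Real.rpow_sub_one hF', e3]
    field_simp
    ring
  · have h := (hexp.mul hfe2).div hfe hne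
    rw [hX, hY, hZ]
    refine h.congr_deriv ?_
    simp only [Pi.mul_apply, ← hξ]
    rw [e3, e4, e5]
    generalize f ξ ^ m = A at *
    generalize f ξ ^ p = B at *
    generalize ξ ^ σ = S at *
    generalize deriv (deriv f) ξ = f2 at *
    generalize deriv f ξ = f1 at *
    generalize f ξ = F at *
    have hβ' : (p - m) / (σ + 2) * α = β := by rw [hα, hβ]; field_simp
    have k : (p - m) / (σ + 2) * (α / m * ξ ^ 2 * (F / A) * (ξ * f1 / F))
        = β / m * ξ ^ 3 * f1 / A := by rw [← hβ']; field_simp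
    rw [k]
    clear k hβ' hα hβ
    have hf2e : f2 = (α * F + β * ξ * f1 - S * B - (((N : ℝ) - 1) / ξ) * (f1 * m * (A / F))
        - f1 * m * (f1 * (m - 1) * (A / F / F))) / (m * (A / F)) := by
      rw [eq_div_iff (by positivity)]
      linarith
    rw [hf2e]
    field_simp
    ring
  · have h := ((hexp.rpow_const (p := σ + 2) (Or.inl (Real.exp_pos η).ne')).const_mul (1 / m)).mul
      (hfe.rpow_const (p := p - m) (Or.inl hne))
    rw [hZ, hY]
    refine h.congr_deriv ?_
    simp only [← hξ]
    rw [Real.rpow_sub_one hF', Real.rpow_sub_one hξ']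
    field_simp
end

section
/- The set of points (X,Y,Z) ∈ ℝ³ with X ≥ 0 and Z ≥ 0 at which the right-hand side of the system (S) vanishes equals {P₀, P₁, P₃} if m < p ≤ p_c(σ), and equals {P₀, P₁, P₂, P₃} if p > p_c(σ), where P₀ = (0,0,0), P₁ = (0, -(N-2)/m, 0), P₂ = (0, -(σ+2)/(p-m), (σ+2)(p(N-2)-m(N+σ))/(p-m)²), and P₃ = (2(σ+2)(mN-N+2)/(L(m-1)), 2/(m-1), 0). -/
theorem aux_mem (n m σ p : ℝ) (hn : 3 ≤ n) (hm : 1 < m) (hσ : -2 < σ) (hp : m < p)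
    (X Y Z : ℝ) :
    (0 ≤ X ∧ 0 ≤ Z ∧ X * (2 - (m - 1) * Y) = 0 ∧
      X - (n - 2) * Y - Z - m * Y ^ 2 + (p - m) / (σ + 2) * (X * Y) = 0 ∧
      Z * (σ + 2 + (p - m) * Y) = 0) ↔
    ((X = 0 ∧ Y = 0 ∧ Z = 0) ∨ (X = 0 ∧ Y = -(n - 2) / m ∧ Z = 0) ∨
      (0 ≤ p * (n - 2) - m * (n + σ) ∧ X = 0 ∧ Y = -(σ + 2) / (p - m) ∧
        Z = (σ + 2) * (p * (n - 2) - m * (n + σ)) / (p - m) ^ 2) ∨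
      (X = 2 * (σ + 2) * (m * n - n + 2) / ((σ * (m - 1) + 2 * (p - 1)) * (m - 1)) ∧
        Y = 2 / (m - 1) ∧ Z = 0)) := by
  have h1 : 0 < m - 1 := by linarith
  have h2 : 0 < σ + 2 := by linarith
  have h3 : 0 < p - m := by linarith
  have h0 : 0 < m := by linarith
  have hL : 0 < σ * (m - 1) + 2 * (p - 1) := by nlinarith [mul_pos h1 h2]
  have hk : 0 < m * n - n + 2 := by nlinarith
  have e1 := h1.ne'
  have e2 := h2.ne'
  have e3 := h3.ne'
  have e0 := h0.ne'
  have eL := hL.ne'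
  constructor
  · rintro ⟨hX, hZ, a, b, c⟩
    rcases mul_eq_zero.1 a with a | a
    · subst a
      rcases mul_eq_zero.1 c with c | c
      · subst c
        have : Y * ((n - 2) + m * Y) = 0 := by linear_combination -b
        rcases mul_eq_zero.1 this with h | h
        · exact Or.inl ⟨rfl, h, rfl⟩
        · refine Or.inr (Or.inl ⟨rfl, ?_, rfl⟩)
          rw [eq_div_iff e0]; linarith
      · have hZe : Z * (p - m) ^ 2 = (σ + 2) * (p * (n - 2) - m * (n + σ)) := by
          linear_combination (-(p - m) ^ 2) * b - ((n - 2) * (p - m) + m * ((p - m) * Y - (σ + 2))) * c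
        refine Or.inr (Or.inr (Or.inl ⟨?_, rfl, ?_, ?_⟩))
        · have : 0 ≤ (σ + 2) * (p * (n - 2) - m * (n + σ)) := by rw [← hZe]; positivity
          exact nonneg_of_mul_nonneg_right this h2
        · rw [eq_div_iff e3]; linarith
        · rw [eq_div_iff (by positivity)]; exact hZe
    · have hY : Y = 2 / (m - 1) := by rw [eq_div_iff e1]; linarith
      have hYp : 0 < Y := by rw [hY]; positivity
      have hZ0 : Z = 0 := by
        rcases mul_eq_zero.1 c with c | c
        · exact c
        · have := mul_pos h3 hYp
          linarith
      refine Or.inr (Or.inr (Or.inr ⟨?_, hY, hZ0⟩))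
      subst hZ0
      rw [hY] at b
      field_simp at b
      rw [eq_div_iff (by positivity)]
      linear_combination b
  · rintro (⟨rfl, rfl, rfl⟩ | ⟨rfl, rfl, rfl⟩ | ⟨h, rfl, rfl, rfl⟩ | ⟨rfl, rfl, rfl⟩)
    · simp
    · refine ⟨le_rfl, le_rfl, by ring, ?_, by ring⟩
      field_simp
      ring
    · refine ⟨le_rfl, by positivity, by ring, ?_, ?_⟩
      · field_simp
        ring
      · field_simp
        ring
    · refine ⟨by positivity, le_rfl, ?_, ?_, by ring⟩
      · field_simp
        ring
      · field_simp
        ring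

/-- The equilibrium points of the system (S) in the quadrant `{X ≥ 0, Z ≥ 0}`
are exactly `{P₀, P₁, P₃}` if `m < p ≤ p_c(σ)`, and `{P₀, P₁, P₂, P₃}` if `p > p_c(σ)`. -/
theorem stmt_1
    (N : ℕ) (hN : 3 ≤ N)
    (m σ p L pc : ℝ)
    (hm : 1 < m) (hσ : -2 < σ) (hp : m < p)
    (hL : L = σ * (m - 1) + 2 * (p - 1))
    (hpc : pc = m * ((N : ℝ) + σ) / ((N : ℝ) - 2))
    (E : Set (ℝ × ℝ × ℝ))
    (hE : E = {q : ℝ × ℝ × ℝ | 0 ≤ q.1 ∧ 0 ≤ q.2.2 ∧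
        q.1 * (2 - (m - 1) * q.2.1) = 0 ∧
        q.1 - ((N : ℝ) - 2) * q.2.1 - q.2.2 - m * q.2.1 ^ 2
          + (p - m) / (σ + 2) * (q.1 * q.2.1) = 0 ∧
        q.2.2 * (σ + 2 + (p - m) * q.2.1) = 0}) :
    (p ≤ pc → E = {((0 : ℝ), (0 : ℝ), (0 : ℝ)),
        ((0 : ℝ), -((N : ℝ) - 2) / m, (0 : ℝ)),
        (2 * (σ + 2) * (m * (N : ℝ) - (N : ℝ) + 2) / (L * (m - 1)), 2 / (m - 1), (0 : ℝ))}) ∧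
    (pc < p → E = {((0 : ℝ), (0 : ℝ), (0 : ℝ)),
        ((0 : ℝ), -((N : ℝ) - 2) / m, (0 : ℝ)),
        ((0 : ℝ), -(σ + 2) / (p - m),
          (σ + 2) * (p * ((N : ℝ) - 2) - m * ((N : ℝ) + σ)) / (p - m) ^ 2),
        (2 * (σ + 2) * (m * (N : ℝ) - (N : ℝ) + 2) / (L * (m - 1)), 2 / (m - 1), (0 : ℝ))}) := by
  have hn : (3 : ℝ) ≤ (N : ℝ) := by exact_mod_cast hN
  have hn2 : 0 < (N : ℝ) - 2 := by linarith
  have h2 : 0 < σ + 2 := by linarith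
  have h3 : 0 < p - m := by linarith
  subst hL hpc hE
  constructor
  · intro h
    rw [le_div_iff₀ hn2] at h
    ext ⟨X, Y, Z⟩
    simp only [Set.mem_setOf_eq, Set.mem_insert_iff, Set.mem_singleton_iff, Prod.mk.injEq]
    rw [aux_mem N m σ p hn hm hσ hp]
    constructor
    · rintro (q | q | ⟨q, rfl, rfl, rfl⟩ | q)
      · exact Or.inl q
      · exact Or.inr (Or.inl q)
      · have e : p * ((N : ℝ) - 2) - m * ((N : ℝ) + σ) = 0 := by linarith
        refine Or.inr (Or.inl ⟨rfl, ?_, by rw [e]; simp⟩)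
        rw [div_eq_div_iff h3.ne' (by linarith)]
        linear_combination e
      · exact Or.inr (Or.inr q)
    · tauto
  · intro h
    rw [div_lt_iff₀ hn2] at h
    have h' : 0 ≤ p * ((N : ℝ) - 2) - m * ((N : ℝ) + σ) := by linarith
    ext ⟨X, Y, Z⟩
    simp only [Set.mem_setOf_eq, Set.mem_insert_iff, Set.mem_singleton_iff, Prod.mk.injEq]
    rw [aux_mem N m σ p hn hm hσ hp]
    tauto
end

section
/- Let P₃ = (2(σ+2)(mN-N+2)/(L(m-1)), 2/(m-1), 0) and A = -[(1-m)²N(σ+2) + 2(m²-1)σ + 4(mp-1)]/(L(m-1)). Then the characteristic polynomial of the Jacobian matrix of the vector field of the system (S) at P₃ equals (t - L/(m-1))·(t² - A t + 2(mN-N+2)/(m-1)). Moreover A < 0, L/(m-1) > 0 and 2(mN-N+2)/(m-1) > 0, so besides the positive eigenvalue L/(m-1) the remaining two eigenvalues are either both real and negative or complex conjugate with negative real part. -/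
theorem jac_aux (a b c d : ℝ) (m n k s : ℝ) (F : (Fin 3 → ℝ) → (Fin 3 → ℝ))
    (hF : F = fun q => ![q 0 * (2 - (m - 1) * q 1),
        q 0 - (n - 2) * q 1 - q 2 - m * (q 1) ^ 2 + k * (q 0 * q 1),
        q 2 * (s + d * q 1)])
    (J : Matrix (Fin 3) (Fin 3) ℝ)
    (hJ : HasFDerivAt F (LinearMap.toContinuousLinearMap J.mulVecLin) ![a, b, c]) :
    J = !![2 - (m - 1) * b, -((m - 1) * a), 0;
           1 + k * b, -(n - 2) - 2 * m * b + k * a, -1;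
           0, c * d, s + d * b] := by
  have key : ∀ j : Fin 3, ∀ i : Fin 3, HasDerivAt
      (fun t : ℝ => F (![a, b, c] + t • (Pi.single j 1 : Fin 3 → ℝ)) i) (J i j) 0 := by
    intro j i
    have hl : HasDerivAt (fun t : ℝ => ![a, b, c] + t • (Pi.single j 1 : Fin 3 → ℝ))
        (Pi.single j 1) 0 := by
      simpa using ((hasDerivAt_id (0 : ℝ)).smul_const (Pi.single j 1 : Fin 3 → ℝ)).const_add
        ![a, b, c]
    have h2 := HasFDerivAt.comp_hasDerivAt_of_eq (0 : ℝ) hJ hl (by simp)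
    have h3 := (hasDerivAt_pi.1 h2) i
    simpa using h3
  have q : ∀ α β γ : ℝ, HasDerivAt (fun t : ℝ => α + β * t + γ * t ^ 2) β 0 := by
    intro α β γ
    have := (((hasDerivAt_id (0 : ℝ)).const_mul β).const_add α).add
      (((hasDerivAt_id (0 : ℝ)).pow 2).const_mul γ)
    refine HasDerivAt.congr_deriv (f := fun t : ℝ => α + β * t + γ * t ^ 2) this ?_
    simp
  have fin : ∀ i j : Fin 3, ∀ α β γ : ℝ,
      (∀ t : ℝ, F (![a, b, c] + t • (Pi.single j 1 : Fin 3 → ℝ)) i = α + β * t + γ * t ^ 2) →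
      J i j = β := by
    intro i j α β γ h
    have h1 := key j i
    rw [funext h] at h1
    exact h1.unique (q α β γ)
  subst hF
  ext i j
  fin_cases i <;> fin_cases j
  · exact fin 0 0 (a * (2 - (m - 1) * b)) _ 0 (by intro t; simp; ring)
  · exact fin 0 1 (a * (2 - (m - 1) * b)) _ 0 (by intro t; simp; ring)
  · exact fin 0 2 (a * (2 - (m - 1) * b)) _ 0 (by intro t; simp)
  · exact fin 1 0 (a - (n - 2) * b - c - m * b ^ 2 + k * (a * b)) _ 0 (by intro t; simp; ring)
  · exact fin 1 1 (a - (n - 2) * b - c - m * b ^ 2 + k * (a * b)) _ (-m)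
      (by intro t; simp; ring)
  · exact fin 1 2 (a - (n - 2) * b - c - m * b ^ 2 + k * (a * b)) _ 0 (by intro t; simp; ring)
  · exact fin 2 0 (c * (s + d * b)) _ 0 (by intro t; simp)
  · exact fin 2 1 (c * (s + d * b)) _ 0 (by intro t; simp; ring)
  · exact fin 2 2 (c * (s + d * b)) _ 0 (by intro t; simp; ring)

theorem charpoly_aux (a b c d e B A l : ℝ) (h1 : b * d = -B) (h2 : e = A) (h3 : c = l) :
    (!![0, b, 0; d, e, -1; 0, 0, c] : Matrix (Fin 3) (Fin 3) ℝ).charpoly =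
    (Polynomial.X - Polynomial.C l) *
      (Polynomial.X ^ 2 - Polynomial.C A * Polynomial.X + Polynomial.C B) := by
  have hB : B = -(b * d) := by linarith
  subst h2 h3 hB
  rw [Matrix.charpoly, Matrix.det_fin_three]
  simp [Matrix.charmatrix_apply]
  ring

/-- The characteristic polynomial of the Jacobian matrix of the vector field of
the system (S) at `P₃` equals `(t - L/(m-1))·(t² - A t + 2(mN-N+2)/(m-1))`, with
`A = -[(1-m)²N(σ+2) + 2(m²-1)σ + 4(mp-1)]/(L(m-1)) < 0`, `L/(m-1) > 0` and
`2(mN-N+2)/(m-1) > 0`; besides the positive eigenvalue `L/(m-1)`, the remaining two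
eigenvalues (the complex roots of `t² - A t + 2(mN-N+2)/(m-1)`) have negative real part. -/
theorem stmt_3
    (N : ℕ) (hN : 3 ≤ N)
    (m σ p L A : ℝ)
    (hm : 1 < m) (hσ : -2 < σ) (hp : m < p)
    (hL : L = σ * (m - 1) + 2 * (p - 1))
    (hA : A = -((1 - m) ^ 2 * (N : ℝ) * (σ + 2) + 2 * (m ^ 2 - 1) * σ + 4 * (m * p - 1))
      / (L * (m - 1)))
    (F : (Fin 3 → ℝ) → (Fin 3 → ℝ))
    (hF : F = fun q => ![q 0 * (2 - (m - 1) * q 1),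
        q 0 - ((N : ℝ) - 2) * q 1 - q 2 - m * (q 1) ^ 2 + (p - m) / (σ + 2) * (q 0 * q 1),
        q 2 * (σ + 2 + (p - m) * q 1)])
    (P3 : Fin 3 → ℝ)
    (hP3 : P3 = ![2 * (σ + 2) * (m * (N : ℝ) - (N : ℝ) + 2) / (L * (m - 1)), 2 / (m - 1), 0])
    (J : Matrix (Fin 3) (Fin 3) ℝ)
    (hJ : HasFDerivAt F (LinearMap.toContinuousLinearMap J.mulVecLin) P3) :
    J.charpoly = (Polynomial.X - Polynomial.C (L / (m - 1))) *
      (Polynomial.X ^ 2 - Polynomial.C A * Polynomial.X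
        + Polynomial.C (2 * (m * (N : ℝ) - (N : ℝ) + 2) / (m - 1))) ∧
    A < 0 ∧ 0 < L / (m - 1) ∧ 0 < 2 * (m * (N : ℝ) - (N : ℝ) + 2) / (m - 1) ∧
    ∀ z : ℂ, z ^ 2 - (A : ℂ) * z + ((2 * (m * (N : ℝ) - (N : ℝ) + 2) / (m - 1) : ℝ) : ℂ) = 0 →
      z.re < 0 := by
  have hN' : (3 : ℝ) ≤ N := by exact_mod_cast hN
  have hm0 : 0 < m - 1 := by linarith
  have hs0 : 0 < σ + 2 := by linarith
  have hp0 : 0 < p - m := by linarith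
  have hL0 : 0 < L := by
    have : L = (σ + 2) * (m - 1) + 2 * (p - m) := by rw [hL]; ring
    rw [this]; positivity
  have hmn : 0 < m * (N : ℝ) - (N : ℝ) + 2 := by
    have : 0 < (m - 1) * (N : ℝ) := by positivity
    linarith
  have hB : 0 < 2 * (m * (N : ℝ) - (N : ℝ) + 2) / (m - 1) := by positivity
  have hA0 : A < 0 := by
    rw [hA]
    apply div_neg_of_neg_of_pos _ (by positivity)
    have e : (1 - m) ^ 2 * (N : ℝ) * (σ + 2) + 2 * (m ^ 2 - 1) * σ + 4 * (m * p - 1)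
      = (m - 1) ^ 2 * (N : ℝ) * (σ + 2) + 2 * ((m - 1) * (m + 1)) * (σ + 2)
        + 4 * (m * (p - m)) := by ring
    rw [e, neg_lt_zero]
    have : 0 < m := by linarith
    positivity
  refine ⟨?_, hA0, by positivity, hB, ?_⟩
  · subst hP3
    have hm1 := hm0.ne'
    have hs1 := hs0.ne'
    have hL1 := hL0.ne'
    rw [jac_aux _ _ _ _ _ _ _ _ F hF J hJ]
    have e1 : 2 - (m - 1) * (2 / (m - 1)) = 0 := by field_simp; ring
    rw [e1, zero_mul]
    apply charpoly_aux 0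
    · have : 1 + (p - m) / (σ + 2) * (2 / (m - 1)) = L / ((m - 1) * (σ + 2)) := by
        rw [hL]; field_simp; ring
      rw [this]; field_simp
    · rw [hA]; field_simp; rw [hL]; ring
    · rw [hL]; field_simp; ring
  · intro z hz
    generalize 2 * (m * (N : ℝ) - (N : ℝ) + 2) / (m - 1) = B at hB hz
    have hr := congrArg Complex.re hz
    have hi := congrArg Complex.im hz
    simp [pow_two] at hr hi
    by_contra! hx
    have hy : z.im * (2 * z.re - A) = 0 := by linarith
    have hy0 : z.im = 0 := by
      rcases mul_eq_zero.1 hy with h | h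
      · exact h
      · linarith
    rw [hy0] at hr
    nlinarith [mul_nonneg hx hx, mul_nonneg hx (neg_nonneg.2 hA0.le)]
end

section
/- The set of (X̄,Ȳ,Z̄) ∈ ℝ³ with X̄ ≥ 0, Z̄ ≥ 0 and X̄² + Ȳ² + Z̄² = 1 satisfying the three equations X̄Ȳ[(p-m)X̄ - (σ+2)Ȳ] = 0, (p-1)X̄Z̄Ȳ = 0, and ȲZ̄[p(σ+2)Ȳ - (p-m)X̄] = 0 is exactly the union of: the quarter circle {(X̄, 0, Z̄) : X̄ ≥ 0, Z̄ ≥ 0, X̄² + Z̄² = 1}, the two points (0, 1, 0) and (0, -1, 0), and the point ((σ+2)/D, (p-m)/D, 0) with D = √((σ+2)² + (p-m)²). -/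
/-- Classification of the critical points at infinity on the equator of the
Poincaré hypersphere: the solutions with `X̄ ≥ 0`, `Z̄ ≥ 0`, `X̄² + Ȳ² + Z̄² = 1` of the system
`X̄Ȳ[(p-m)X̄ - (σ+2)Ȳ] = 0`, `(p-1)X̄Z̄Ȳ = 0`, `ȲZ̄[p(σ+2)Ȳ - (p-m)X̄] = 0` are exactly the
quarter circle `{Ȳ = 0}`, the two points `(0,±1,0)`, and the point `((σ+2)/D, (p-m)/D, 0)`
with `D = √((σ+2)² + (p-m)²)`. -/
theorem stmt_4
    (m σ p D : ℝ)
    (hm : 1 < m) (hσ : -2 < σ) (hp : m < p)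
    (hD : D = Real.sqrt ((σ + 2) ^ 2 + (p - m) ^ 2)) :
    {q : ℝ × ℝ × ℝ | 0 ≤ q.1 ∧ 0 ≤ q.2.2 ∧ q.1 ^ 2 + q.2.1 ^ 2 + q.2.2 ^ 2 = 1 ∧
        q.1 * q.2.1 * ((p - m) * q.1 - (σ + 2) * q.2.1) = 0 ∧
        (p - 1) * q.1 * q.2.2 * q.2.1 = 0 ∧
        q.2.1 * q.2.2 * (p * (σ + 2) * q.2.1 - (p - m) * q.1) = 0}
      = {q : ℝ × ℝ × ℝ | 0 ≤ q.1 ∧ q.2.1 = 0 ∧ 0 ≤ q.2.2 ∧ q.1 ^ 2 + q.2.2 ^ 2 = 1}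
        ∪ {((0 : ℝ), (1 : ℝ), (0 : ℝ)), ((0 : ℝ), (-1 : ℝ), (0 : ℝ))}
        ∪ {(((σ + 2) / D, (p - m) / D, (0 : ℝ)) : ℝ × ℝ × ℝ)} := by
  have ha : 0 < σ + 2 := by linarith
  have hb : 0 < p - m := by linarith
  have hp1 : p - 1 ≠ 0 := by
    have : 0 < p - 1 := by linarith
    exact this.ne'
  have hp0 : p ≠ 0 := by
    have : 0 < p := by linarith
    exact this.ne'
  have hDpos : 0 < D := by rw [hD]; positivity
  have hD2 : D ^ 2 = (σ + 2) ^ 2 + (p - m) ^ 2 := by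
    rw [hD]; exact Real.sq_sqrt (by positivity)
  clear hD
  generalize σ + 2 = a at *
  generalize p - m = b at *
  ext ⟨x, y, z⟩
  simp only [Set.mem_setOf_eq, Set.mem_union, Set.mem_insert_iff, Set.mem_singleton_iff,
    Prod.mk.injEq]
  constructor
  · rintro ⟨hx, hz, h1, h2, h3, h4⟩
    by_cases hy : y = 0
    · subst hy
      exact Or.inl (Or.inl ⟨hx, rfl, hz, by linarith⟩)
    by_cases hx0 : x = 0
    · subst hx0
      have hz0 : z = 0 := by
        have : p * a * y ≠ 0 := mul_ne_zero (mul_ne_zero hp0 ha.ne') hy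
        simpa [hy, hp0, ha.ne'] using h4
      subst hz0
      have : y ^ 2 = 1 := by linarith
      rcases eq_or_eq_neg_of_sq_eq_sq y 1 (by linarith) with h | h
      · exact Or.inl (Or.inr (Or.inl ⟨rfl, h, rfl⟩))
      · exact Or.inl (Or.inr (Or.inr ⟨rfl, h, rfl⟩))
    · have hz0 : z = 0 := by simpa [hy, hx0, hp1] using h3
      subst hz0
      have h5 : b * x - a * y = 0 := by simpa [hy, hx0] using h2
      have h6 : b * x = a * y := by linarith
      have h7 : (x * D) ^ 2 = a ^ 2 := by
        have : (b * x) ^ 2 = (a * y) ^ 2 := by rw [h6]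
        linear_combination x ^ 2 * hD2 + this + a ^ 2 * h1
      have h8 : x * D = a := (sq_eq_sq₀ (by positivity) ha.le).mp h7
      have h9 : y * D = b := by
        apply mul_left_cancel₀ ha.ne'
        linear_combination b * h8 - D * h6
      exact Or.inr ⟨by rw [eq_div_iff hDpos.ne']; exact h8,
        by rw [eq_div_iff hDpos.ne']; exact h9, rfl⟩
  · rintro ((⟨hx, rfl, hz, h⟩ | ⟨rfl, rfl, rfl⟩ | ⟨rfl, rfl, rfl⟩) | ⟨rfl, rfl, rfl⟩)
    · exact ⟨hx, hz, by linarith, by ring, by ring, by ring⟩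
    · norm_num
    · norm_num
    · refine ⟨by positivity, le_refl _, ?_, by ring, by ring, by ring⟩
      field_simp
      linarith
end

section
/- Consider the planar system (S₀): Y' = -(N-2)Y - Z - mY², Z' = Z(σ+2+(p-m)Y). At any point of the curve Z = -((N+σ)/(N-2))(mY+N-2)Y, the inner product of the vector field of (S₀) with the normal vector n̄ = (((N+σ)/(N-2))(2mY+N-2), 1) equals H(Y) = ((N+σ)/(N-2))(p_s(σ)-p)·Y²·(mY+N-2). In particular, if p < p_s(σ) and -(N-2)/m < Y < 0, then H(Y) > 0. -/
/-- For the planar system (S₀) (restriction of (S) to `{X = 0}`), at any point of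
the curve `Z = -((N+σ)/(N-2))(mY+N-2)Y`, the inner product of the vector field with the normal
`n̄ = (((N+σ)/(N-2))(2mY+N-2), 1)` equals
`H(Y) = ((N+σ)/(N-2))(p_s(σ)-p) Y² (mY+N-2)`; in particular, if `p < p_s(σ)` and
`-(N-2)/m < Y < 0`, then `H(Y) > 0`. -/
theorem stmt_5
    (N : ℕ) (hN : 3 ≤ N)
    (m σ p ps : ℝ)
    (hm : 1 < m) (hσ : -2 < σ) (hp : m < p)
    (hps : ps = m * ((N : ℝ) + 2 * σ + 2) / ((N : ℝ) - 2)) :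
    ∀ Y Z H : ℝ,
      Z = -(((N : ℝ) + σ) / ((N : ℝ) - 2)) * (m * Y + (N : ℝ) - 2) * Y →
      H = ((N : ℝ) + σ) / ((N : ℝ) - 2) * (ps - p) * Y ^ 2 * (m * Y + (N : ℝ) - 2) →
      ((((N : ℝ) + σ) / ((N : ℝ) - 2) * (2 * m * Y + (N : ℝ) - 2))
          * (-(((N : ℝ) - 2) * Y) - Z - m * Y ^ 2)
        + 1 * (Z * (σ + 2 + (p - m) * Y)) = H)
      ∧ (p < ps → -((N : ℝ) - 2) / m < Y → Y < 0 → 0 < H) := by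
  have hN3 : (3 : ℝ) ≤ (N : ℝ) := by exact_mod_cast hN
  have hN2 : (0 : ℝ) < (N : ℝ) - 2 := by linarith
  have hne : (N : ℝ) - 2 ≠ 0 := hN2.ne'
  intro Y Z H hZ hH
  refine ⟨?_, ?_⟩
  · rw [hH, hZ, hps]
    field_simp
    ring
  · intro h1 h2 h3
    rw [hH]
    have hm0 : 0 < m := by linarith
    rw [div_lt_iff₀ hm0] at h2
    have hA : 0 < ((N : ℝ) + σ) / ((N : ℝ) - 2) := div_pos (by linarith) hN2
    have hB : 0 < ps - p := by linarith
    have hC : 0 < Y ^ 2 := sq_pos_of_neg h3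
    have hD : 0 < m * Y + (N : ℝ) - 2 := by linarith
    exact mul_pos (mul_pos (mul_pos hA hB) hC) hD
end

section
/- Consider the planar system (S_Z): X' = X(2-(m-1)Y), Y' = X - (N-2)Y - mY² + ((p-m)/(σ+2))XY, and set a = -(2mN-N-2m+2)/(mN-N+2), b = -(mN-N+2m+2)/(mN-N+2). Then for all X > 0 and Y > 0, ∂/∂X [X^a Y^b · X(2-(m-1)Y)] + ∂/∂Y [X^a Y^b · (X - (N-2)Y - mY² + ((p-m)/(σ+2))XY)] < 0 (the divergence of the field multiplied by the Dulac factor X^a Y^b is strictly negative on the open first quadrant). In particular b < 0 and b + 1 = -2m/(mN-N+2) < 0. -/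
/-- Dulac's criterion for the planar system (S_Z) (restriction of (S) to `{Z=0}`):
with `a = -(2mN-N-2m+2)/(mN-N+2)` and `b = -(mN-N+2m+2)/(mN-N+2)`, the divergence of the
vector field multiplied by the Dulac factor `X^a Y^b` is strictly negative on the open first
quadrant; moreover `b < 0` and `b + 1 = -2m/(mN-N+2) < 0`. -/
theorem stmt_7
    (N : ℕ) (hN : 1 ≤ N)
    (m σ p a b : ℝ)
    (hm : 1 < m) (hσ : -2 < σ) (hp : m < p)
    (ha : a = -(2 * m * (N : ℝ) - (N : ℝ) - 2 * m + 2) / (m * (N : ℝ) - (N : ℝ) + 2))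
    (hb : b = -(m * (N : ℝ) - (N : ℝ) + 2 * m + 2) / (m * (N : ℝ) - (N : ℝ) + 2)) :
    (∀ X Y : ℝ, 0 < X → 0 < Y →
      deriv (fun t => t ^ a * Y ^ b * (t * (2 - (m - 1) * Y))) X
        + deriv (fun t => X ^ a * t ^ b *
            (X - ((N : ℝ) - 2) * t - m * t ^ 2 + (p - m) / (σ + 2) * (X * t))) Y < 0)
    ∧ b < 0
    ∧ b + 1 = -(2 * m) / (m * (N : ℝ) - (N : ℝ) + 2)
    ∧ b + 1 < 0 := by
  have hN' : (1 : ℝ) ≤ (N : ℝ) := by exact_mod_cast hN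
  generalize (N : ℝ) = n at *
  have hD : 0 < m * n - n + 2 := by nlinarith
  have hD0 := hD.ne'
  have hD1 : n * (m - 1) + 2 ≠ 0 := by intro h; apply hD0; linarith
  have hb1 : b + 1 = -(2 * m) / (m * n - n + 2) := by
    rw [hb]; field_simp; ring
  have hb1n : b + 1 < 0 := by
    rw [hb1]; exact div_neg_of_neg_of_pos (by linarith) hD
  have hbn : b < 0 := by linarith
  refine ⟨?_, hbn, hb1, hb1n⟩
  intro X Y hX hY
  have ha1 : 2 * (a + 1) = (b + 1) * (n - 2) := by
    rw [hb1, ha]; field_simp; ring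
  have hab : (a + 1) * (m - 1) + (b + 2) * m = 0 := by
    rw [ha, hb]; field_simp; ring
  have hK : 0 < (p - m) / (σ + 2) := div_pos (by linarith) (by linarith)
  generalize (p - m) / (σ + 2) = K at *
  have hxa : HasDerivAt (fun t : ℝ => t ^ a) (a * X ^ (a - 1)) X :=
    Real.hasDerivAt_rpow_const (Or.inl hX.ne')
  have hyb : HasDerivAt (fun t : ℝ => t ^ b) (b * Y ^ (b - 1)) Y :=
    Real.hasDerivAt_rpow_const (Or.inl hY.ne')
  have h1 := ((hxa.mul_const (Y ^ b)).fun_mul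
    ((hasDerivAt_id' X).mul_const (2 - (m - 1) * Y))).deriv
  have h2 := ((hyb.const_mul (X ^ a)).fun_mul
    (((((hasDerivAt_id' Y).const_mul (n - 2)).const_sub X).fun_sub
      (((hasDerivAt_id' Y).fun_pow 2).const_mul m)).fun_add
      (((hasDerivAt_id' Y).const_mul X).const_mul K))).deriv
  rw [h1, h2, Real.rpow_sub_one hX.ne', Real.rpow_sub_one hY.ne']
  have hP : 0 < X ^ a := Real.rpow_pos_of_pos hX a
  have hQ : 0 < Y ^ b := Real.rpow_pos_of_pos hY b
  generalize X ^ a = P at *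
  generalize Y ^ b = Q at *
  have key : b * (X / Y) + (b + 1) * K * X < 0 := by
    have e1 := mul_neg_of_neg_of_pos hbn (div_pos hX hY)
    have e2 := mul_neg_of_neg_of_pos hb1n (mul_pos hK hX)
    linarith
  have := mul_neg_of_pos_of_neg (mul_pos hP hQ) key
  refine lt_of_eq_of_lt ?_ this
  have hX0 := hX.ne'
  have hY0 := hY.ne'
  clear h1 h2 hxa hyb ha hb hb1
  field_simp
  push_cast
  linear_combination (Y * ha1 - Y ^ 2 * hab)
end

section
/- For the system (S), at every point (X,Y,Z) with Y = -(σ+2)/(p-m), the Y-component of the vector field equals F₂(X,Z) = -(σ+2)[m(N+σ) - p(N-2)]/(p-m)² - Z (independently of X). In particular, if m < p ≤ p_c(σ) := m(N+σ)/(N-2) and Z ≥ 0, then F₂(X,Z) ≤ 0, with strict inequality whenever p < p_c(σ) or Z > 0; hence the flow of (S) across the plane {Y = -(σ+2)/(p-m)} points into the region {Y < -(σ+2)/(p-m)} there. -/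
/-- For the system (S), at every point with `Y = -(σ+2)/(p-m)` the `Y`-component
of the vector field equals `F₂(X,Z) = -(σ+2)[m(N+σ)-p(N-2)]/(p-m)² - Z`, independently of `X`.
If `m < p ≤ p_c(σ)` and `Z ≥ 0` then `F₂ ≤ 0`, with strict inequality whenever `p < p_c(σ)`
or `Z > 0`; hence the flow points into the region `{Y < -(σ+2)/(p-m)}` there. -/
theorem stmt_10
    (N : ℕ) (hN : 3 ≤ N)
    (m σ p pc : ℝ)
    (hm : 1 < m) (hσ : -2 < σ) (hp : m < p)
    (hpc : pc = m * ((N : ℝ) + σ) / ((N : ℝ) - 2)) :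
    ∀ X Z F₂ : ℝ,
      F₂ = -(σ + 2) * (m * ((N : ℝ) + σ) - p * ((N : ℝ) - 2)) / (p - m) ^ 2 - Z →
      (X - ((N : ℝ) - 2) * (-(σ + 2) / (p - m)) - Z - m * (-(σ + 2) / (p - m)) ^ 2
          + (p - m) / (σ + 2) * (X * (-(σ + 2) / (p - m))) = F₂)
      ∧ (p ≤ pc → 0 ≤ Z → (F₂ ≤ 0 ∧ ((p < pc ∨ 0 < Z) → F₂ < 0))) := by
  intro X Z F₂ hF
  have hpm : 0 < p - m := by linarith
  have hs : 0 < σ + 2 := by linarith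
  have hN' : (3 : ℝ) ≤ (N : ℝ) := by exact_mod_cast hN
  have hN2 : 0 < (N : ℝ) - 2 := by linarith
  have hpm' : p - m ≠ 0 := hpm.ne'
  have hs' : σ + 2 ≠ 0 := hs.ne'
  have hsq : 0 < (p - m) ^ 2 := by positivity
  have hrw : -(σ + 2) * (m * ((N : ℝ) + σ) - p * ((N : ℝ) - 2)) / (p - m) ^ 2
      = -((σ + 2) * (m * ((N : ℝ) + σ) - p * ((N : ℝ) - 2)) / (p - m) ^ 2) := by ring
  refine ⟨?_, ?_⟩
  · rw [hF]
    field_simp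
    ring
  · intro hle hZ
    rw [hrw] at hF
    have h1 : 0 ≤ m * ((N : ℝ) + σ) - p * ((N : ℝ) - 2) := by
      rw [hpc, le_div_iff₀ hN2] at hle
      linarith
    have h2 : 0 ≤ (σ + 2) * (m * ((N : ℝ) + σ) - p * ((N : ℝ) - 2)) / (p - m) ^ 2 :=
      div_nonneg (mul_nonneg hs.le h1) hsq.le
    refine ⟨by linarith, ?_⟩
    rintro (h | h)
    · rw [hpc, lt_div_iff₀ hN2] at h
      have h3 : 0 < (σ + 2) * (m * ((N : ℝ) + σ) - p * ((N : ℝ) - 2)) / (p - m) ^ 2 :=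
        div_pos (mul_pos hs (by linarith)) hsq
      linarith
    · linarith
end

section
/- For the system (S), at every point of the cylinder Z = -((N+σ)/(N-2))(mY+N-2)Y (with X arbitrary), the inner product of the vector field of (S) with the normal vector ν̄ = (0, ((N+σ)/(N-2))(2mY+N-2), 1) equals E(X,Y;p) = ((N+σ)/(N-2))·[(p_s(σ)-p)·Y²·(mY+N-2) + X·(1 + ((p-m)/(σ+2))Y)·(2mY+N-2)]. Moreover, if p < p_s(σ), X ≥ 0, -(N-2)/m < Y < 0, and either Y ≤ -(σ+2)/(p-m) or Y ≥ -(N-2)/(2m), then E(X,Y;p) > 0. -/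
/-- For the system (S), at every point of the cylinder
`Z = -((N+σ)/(N-2))(mY+N-2)Y`, the inner product of the vector field with the normal
`ν̄ = (0, ((N+σ)/(N-2))(2mY+N-2), 1)` equals
`E(X,Y;p) = ((N+σ)/(N-2))·[(p_s(σ)-p)Y²(mY+N-2) + X(1+((p-m)/(σ+2))Y)(2mY+N-2)]`.
Moreover, if `p < p_s(σ)`, `X ≥ 0`, `-(N-2)/m < Y < 0`, and either `Y ≤ -(σ+2)/(p-m)` or
`Y ≥ -(N-2)/(2m)`, then `E(X,Y;p) > 0`. -/
theorem stmt_11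
    (N : ℕ) (hN : 3 ≤ N)
    (m σ p ps : ℝ)
    (hm : 1 < m) (hσ : -2 < σ) (hp : m < p)
    (hps : ps = m * ((N : ℝ) + 2 * σ + 2) / ((N : ℝ) - 2)) :
    ∀ X Y Z E : ℝ,
      Z = -(((N : ℝ) + σ) / ((N : ℝ) - 2)) * (m * Y + (N : ℝ) - 2) * Y →
      E = ((N : ℝ) + σ) / ((N : ℝ) - 2) * ((ps - p) * Y ^ 2 * (m * Y + (N : ℝ) - 2)
          + X * (1 + (p - m) / (σ + 2) * Y) * (2 * m * Y + (N : ℝ) - 2)) →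
      (0 * (X * (2 - (m - 1) * Y))
          + ((N : ℝ) + σ) / ((N : ℝ) - 2) * (2 * m * Y + (N : ℝ) - 2)
            * (X - ((N : ℝ) - 2) * Y - Z - m * Y ^ 2 + (p - m) / (σ + 2) * (X * Y))
          + 1 * (Z * (σ + 2 + (p - m) * Y)) = E)
      ∧ (p < ps → 0 ≤ X → -((N : ℝ) - 2) / m < Y → Y < 0 →
          (Y ≤ -(σ + 2) / (p - m) ∨ -((N : ℝ) - 2) / (2 * m) ≤ Y) → 0 < E) := by
  have hN' : (3:ℝ) ≤ N := by exact_mod_cast hN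
  intro X Y Z E hZ hE
  obtain ⟨n, hn⟩ : ∃ n : ℝ, n = (N:ℝ) - 2 := ⟨_, rfl⟩
  have hNn : (N:ℝ) = n + 2 := by linarith
  rw [hNn] at hps hZ hE hN' ⊢
  have hn0 : 0 < n := by linarith
  have hs : 0 < σ + 2 := by linarith
  have hq : 0 < p - m := by linarith
  have e1 : n + 2 - 2 = n := by ring
  have e2 : ∀ a : ℝ, a + (n + 2) - 2 = a + n := fun a => by ring
  simp only [e1, e2] at hps hZ hE ⊢
  refine ⟨?_, ?_⟩
  · subst hZ hE hps
    field_simp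
    ring
  · intro hpp hX hY1 hY0 hor
    have hm0 : 0 < m := by linarith
    have h1 : 0 < m * Y + n := by
      rw [div_lt_iff₀ hm0] at hY1
      linarith
    have hk : (p - m) * n < 2 * m * (σ + 2) := by
      rw [hps, lt_div_iff₀ hn0] at hpp
      linarith
    have hA : 0 < (ps - p) * Y ^ 2 * (m * Y + n) :=
      mul_pos (mul_pos (by linarith) (sq_pos_of_neg hY0)) h1
    have e3 : 1 + (p - m) / (σ + 2) * Y = (σ + 2 + (p - m) * Y) / (σ + 2) := by
      field_simp
    have hB : 0 ≤ (σ + 2 + (p - m) * Y) * (2 * m * Y + n) := by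
      rcases hor with h | h
      · rw [le_div_iff₀ hq] at h
        have h3 : (2 * m * Y + n) ≤ 0 := by
          by_contra hc
          push Not at hc
          nlinarith [mul_pos hq hc, mul_nonneg hm0.le (by linarith : 0 ≤ -(σ + 2) - Y * (p - m))]
        exact mul_nonneg_of_nonpos_of_nonpos (by linarith) h3
      · rw [div_le_iff₀ (by linarith)] at h
        have h3 : 0 ≤ σ + 2 + (p - m) * Y := by
          by_contra hc
          push Not at hc
          nlinarith [mul_nonneg hq.le (by linarith : 0 ≤ 2 * m * Y + n), mul_neg_of_pos_of_neg hm0 hc]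
        exact mul_nonneg h3 (by linarith)
    have hC : 0 ≤ X * (1 + (p - m) / (σ + 2) * Y) * (2 * m * Y + n) := by
      rw [e3]
      have : X * ((σ + 2 + (p - m) * Y) / (σ + 2)) * (2 * m * Y + n)
          = X * ((σ + 2 + (p - m) * Y) * (2 * m * Y + n)) / (σ + 2) := by ring
      rw [this]
      exact div_nonneg (mul_nonneg hX hB) hs.le
    rw [hE]
    exact mul_pos (div_pos (by linarith) hn0) (by linarith)
end

section
/- Let (X,Y,Z) : I → ℝ³ be a differentiable solution of the system (S) on an open interval I, and suppose that at some η₀ ∈ I one has Y(η₀) = 0 and Y'(η₀) = 0. Then X(η₀) = Z(η₀), the function Y is twice differentiable at η₀, and Y''(η₀) = -σ·Z(η₀). In particular, if σ < 0 and Z(η₀) > 0, then Y''(η₀) > 0, so η₀ cannot be a local maximum of Y. -/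
/-- If `(X,Y,Z)` is a differentiable solution of the system (S) on an open
interval and at some `η₀` one has `Y(η₀) = 0` and `Y'(η₀) = 0`, then `X(η₀) = Z(η₀)`, `Y` is
twice differentiable at `η₀`, and `Y''(η₀) = -σ·Z(η₀)`. In particular, if `σ < 0` and
`Z(η₀) > 0`, then `Y''(η₀) > 0`, so `η₀` cannot be a local maximum of `Y`. -/
theorem stmt_12
    (N : ℕ) (hN : 3 ≤ N)
    (m σ p : ℝ)
    (hm : 1 < m) (hσ : -2 < σ) (hp : m < p)
    (a b η₀ : ℝ) (hη₀ : η₀ ∈ Set.Ioo a b)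
    (X Y Z : ℝ → ℝ)
    (hX : ∀ η ∈ Set.Ioo a b, HasDerivAt X (X η * (2 - (m - 1) * Y η)) η)
    (hY : ∀ η ∈ Set.Ioo a b, HasDerivAt Y (X η - ((N : ℝ) - 2) * Y η - Z η
        - m * Y η ^ 2 + (p - m) / (σ + 2) * (X η * Y η)) η)
    (hZ : ∀ η ∈ Set.Ioo a b, HasDerivAt Z (Z η * (σ + 2 + (p - m) * Y η)) η)
    (hY0 : Y η₀ = 0)
    (hY'0 : HasDerivAt Y 0 η₀) :
    X η₀ = Z η₀ ∧
    HasDerivAt (deriv Y) (-σ * Z η₀) η₀ ∧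
    (σ < 0 → 0 < Z η₀ → ¬ IsLocalMax Y η₀) := by
  have hXZ : X η₀ = Z η₀ := by
    have h := (hY η₀ hη₀).unique hY'0
    rw [hY0] at h
    linarith
  have hnhds : Set.Ioo a b ∈ nhds η₀ := Ioo_mem_nhds hη₀.1 hη₀.2
  have hD : HasDerivAt (deriv Y) (-σ * Z η₀) η₀ := by
    have h1 := hX η₀ hη₀
    have h2 := hZ η₀ hη₀
    have h := (((h1.sub (hY'0.const_mul ((N : ℝ) - 2))).sub h2).sub
      ((hY'0.pow 2).const_mul m)).add ((h1.mul hY'0).const_mul ((p - m) / (σ + 2)))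
    have h' : HasDerivAt (fun η => X η - ((N : ℝ) - 2) * Y η - Z η
        - m * Y η ^ 2 + (p - m) / (σ + 2) * (X η * Y η)) (-σ * Z η₀) η₀ := by
      refine HasDerivAt.congr_deriv h ?_
      rw [hY0, hXZ]
      ring
    refine h'.congr_of_eventuallyEq ?_
    filter_upwards [hnhds] with η hη
    exact (hY η hη).deriv
  refine ⟨hXZ, hD, ?_⟩
  intro hs hz hmax
  have hpos : 0 < -σ * Z η₀ := mul_pos (by linarith) hz
  have hmin : IsLocalMin Y η₀ :=
    isLocalMin_of_deriv_deriv_pos (by rw [hD.deriv]; exact hpos) hY'0.deriv hY'0.continuousAt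
  have hc : Y =ᶠ[nhds η₀] fun _ => Y η₀ := by
    filter_upwards [hmax, hmin] with η h1 h2
    exact le_antisymm h1 h2
  have h0 := hc.deriv.deriv_eq
  rw [hD.deriv] at h0
  simp at h0
  rcases h0 with h0 | h0 <;> linarith
end

section
/- Let N ≥ 3 be an integer, m > 1, σ > -2, C > 0, and let p = p_s(σ) = m(N+2σ+2)/(N-2). Then the function f : (0,∞) → (0,∞) defined by f(ξ) = [(N-2)(N+σ)C / (ξ^{σ+2} + C)²]^{(N-2)/(2m(σ+2))} satisfies (f^m)''(ξ) + ((N-1)/ξ)(f^m)'(ξ) + ξ^σ f(ξ)^p = 0 for every ξ > 0; that is, U_C(x) = f(|x|) is an explicit radially symmetric stationary solution of u_t = Δu^m + |x|^σ u^p when p = p_s(σ). -/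
/-- For `p = p_s(σ) = m(N+2σ+2)/(N-2)` and any `C > 0`, the function
`f(ξ) = [(N-2)(N+σ)C / (ξ^{σ+2} + C)²]^{(N-2)/(2m(σ+2))}` is positive and satisfies
`(f^m)'' + ((N-1)/ξ)(f^m)' + ξ^σ f^p = 0` for every `ξ > 0`; that is, `U_C(x) = f(|x|)` is an
explicit radially symmetric stationary solution of `u_t = Δu^m + |x|^σ u^p`. -/
theorem stmt_13
    (N : ℕ) (hN : 3 ≤ N)
    (m σ C p : ℝ)
    (hm : 1 < m) (hσ : -2 < σ) (hC : 0 < C)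
    (hp : p = m * ((N : ℝ) + 2 * σ + 2) / ((N : ℝ) - 2))
    (f : ℝ → ℝ)
    (hf : f = fun ξ => (((N : ℝ) - 2) * ((N : ℝ) + σ) * C / (ξ ^ (σ + 2) + C) ^ 2)
        ^ (((N : ℝ) - 2) / (2 * m * (σ + 2)))) :
    ∀ ξ ∈ Set.Ioi (0 : ℝ), 0 < f ξ ∧
      deriv (deriv (fun t => f t ^ m)) ξ
        + (((N : ℝ) - 1) / ξ) * deriv (fun t => f t ^ m) ξ
        + ξ ^ σ * f ξ ^ p = 0 := by
  have hn : (3:ℝ) ≤ N := by exact_mod_cast hN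
  generalize (N : ℝ) = n at *
  obtain ⟨s, hs⟩ : ∃ s, s = σ + 2 := ⟨_, rfl⟩
  have hs0 : 0 < s := by linarith
  have hσs : σ = s - 2 := by linarith
  subst hσs
  clear hs
  rw [sub_add_cancel] at hf
  obtain ⟨a, ha⟩ : ∃ a, a = (n - 2) / s := ⟨_, rfl⟩
  have has : a * s = n - 2 := by rw [ha]; field_simp
  obtain ⟨A, hA⟩ : ∃ A, A = (n - 2) * (n + (s - 2)) * C := ⟨_, rfl⟩
  have hA0 : 0 < A := by
    rw [hA]
    have h1 : 0 < n - 2 := by linarith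
    have h2 : 0 < n + (s - 2) := by linarith
    positivity
  rw [← hA] at hf
  have hw : ∀ t : ℝ, 0 < t → 0 < t ^ s + C := fun t ht => by positivity
  have hm0 : m ≠ 0 := by linarith
  have hn2 : n - 2 ≠ 0 := by linarith
  have hpow : ∀ y w : ℝ, 0 < w → (A / w ^ 2) ^ y = A ^ y * w ^ (-(2 * y)) := by
    intro y w hw
    rw [Real.div_rpow hA0.le (by positivity), ← Real.rpow_natCast, ← Real.rpow_mul hw.le,
      Real.rpow_neg hw.le]
    rfl
  have hfm : ∀ t : ℝ, 0 < t → f t ^ m = A ^ (a / 2) * (t ^ s + C) ^ (-a) := by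
    intro t ht
    have := hw t ht
    rw [hf]
    simp only
    rw [← Real.rpow_mul (by positivity), hpow _ _ this]
    have : (n - 2) / (2 * m * s) * m = a / 2 := by rw [ha]; field_simp
    rw [this]
    congr 2
    ring
  have hfp : ∀ t : ℝ, 0 < t → f t ^ p = A ^ (a / 2) * A * (t ^ s + C) ^ (-a - 2) := by
    intro t ht
    have := hw t ht
    rw [hf]
    simp only
    rw [← Real.rpow_mul (by positivity), hpow _ _ this]
    have : (n - 2) / (2 * m * s) * p = a / 2 + 1 := by
      rw [ha, hp]; field_simp; ring
    rw [this, Real.rpow_add hA0, Real.rpow_one]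
    congr 2
    ring
  have hd1 : ∀ t : ℝ, 0 < t → deriv (fun t => f t ^ m) t
      = -(A ^ (a / 2) * (n - 2)) * ((t ^ s + C) ^ (-a - 1) * t ^ (s - 1)) := by
    intro t ht
    have he : (fun t => f t ^ m) =ᶠ[nhds t] fun t => A ^ (a / 2) * (t ^ s + C) ^ (-a) := by
      filter_upwards [Ioi_mem_nhds ht] with x hx using hfm x hx
    rw [he.deriv_eq]
    have h := ((((Real.hasDerivAt_rpow_const (p := s) (Or.inl ht.ne')).add_const C).rpow_const
      (p := -a) (Or.inl (hw t ht).ne')).const_mul (A ^ (a / 2)))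
    rw [h.deriv, ← has]
    ring
  intro ξ hξ
  have hξ : 0 < ξ := hξ
  have hwξ := hw ξ hξ
  refine ⟨by rw [hf]; positivity, ?_⟩
  have he : deriv (fun t => f t ^ m) =ᶠ[nhds ξ] fun t =>
      -(A ^ (a / 2) * (n - 2)) * ((t ^ s + C) ^ (-a - 1) * t ^ (s - 1)) := by
    filter_upwards [Ioi_mem_nhds hξ] with x hx using hd1 x hx
  have h := ((((Real.hasDerivAt_rpow_const (p := s) (Or.inl hξ.ne')).add_const C).rpow_const
      (p := -a - 1) (Or.inl hwξ.ne')).mul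
      (Real.hasDerivAt_rpow_const (p := s - 1) (Or.inl hξ.ne'))).const_mul
      (-(A ^ (a / 2) * (n - 2)))
  have h2 : deriv (deriv (fun t => f t ^ m)) ξ = _ := he.deriv_eq.trans h.deriv
  rw [h2, hd1 ξ hξ, hfp ξ hξ]
  have e1 : ξ ^ (s - 1) = ξ ^ (s - 2) * ξ := by
    rw [← Real.rpow_add_one hξ.ne']; congr 1; ring
  have e0 : ξ ^ s = ξ ^ (s - 2) * ξ * ξ := by
    rw [← e1, ← Real.rpow_add_one hξ.ne']; congr 1; ring
  have e2 : (ξ ^ s + C) ^ (-a - 1) = (ξ ^ s + C) ^ (-a - 2) * (ξ ^ s + C) := by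
    rw [← Real.rpow_add_one hwξ.ne']; congr 1; ring
  have e3 : (-a - 1 - 1 : ℝ) = -a - 2 := by ring
  have e4 : (s - 1 - 1 : ℝ) = s - 2 := by ring
  rw [e3, e4, e2, e1]
  generalize (ξ ^ s + C) ^ (-a - 2) = W
  rw [e0, hA]
  generalize ξ ^ (s - 2) = X
  generalize A ^ (a / 2) = K
  have hn' : n = a * s + 2 := by linarith
  rw [hn']
  field_simp
  ring
end

section
/- Let N ≥ 1 be an integer, m > 1, σ ≥ σ* := (mN+2)/(m-1), and m < p ≤ p_F(σ) = m + (σ+2)/N. Let v : ℝ^N → [0,∞) be continuous with V := v^m twice continuously differentiable, solving -ΔV(y) + α v(y) + β y·∇V^{1/m}(y) - |y|^σ v(y)^p = 0 on ℝ^N, and suppose there exist constants C₁, C₂ > 0 and R > 0 such that v(y) ≤ C₁|y|^{-(σ+2)/(p-m)} and |∇v(y)| ≤ C₂|y|^{-(σ+2)/(p-m)-1} for all |y| ≥ R. Then v ≡ 0 on ℝ^N; that is, the equation u_t = Δu^m + |x|^σ u^p admits no nontrivial self-similar blow-up solution with such a profile in this range. -/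
open MeasureTheory

lemma aux_div {N : ℕ} (F : Fin N → EuclideanSpace ℝ (Fin N) → ℝ)
    (hF : ∀ i, ContDiff ℝ 1 (F i)) (C ρ : ℝ)
    (hdec : ∀ i y, ρ ≤ ‖y‖ → |F i y| ≤ C * (‖y‖ ^ N)⁻¹)
    (hnn : ∀ y, 0 ≤ ∑ i, fderiv ℝ (F i) y (EuclideanSpace.single i 1)) :
    ∀ y, ∑ i, fderiv ℝ (F i) y (EuclideanSpace.single i 1) = 0 := by
  intro y0
  by_contra hy0
  set g : EuclideanSpace ℝ (Fin N) → ℝ :=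
    fun y => ∑ i, fderiv ℝ (F i) y (EuclideanSpace.single i 1) with hg
  have hdFc : ∀ i, Continuous fun y => fderiv ℝ (F i) y (EuclideanSpace.single i 1) :=
    fun i => ((hF i).continuous_fderiv (by simp)).clm_apply continuous_const
  have hgc : Continuous g := continuous_finsetSum _ fun i _ => hdFc i
  -- bump around
  let φ0 : ContDiffBump (0 : EuclideanSpace ℝ (Fin N)) :=
    ⟨‖y0‖ + 1, ‖y0‖ + 2, by positivity, by linarith⟩
  have hI0 : 0 < ∫ y, φ0 y * g y := by
    refine Continuous.integral_pos_of_hasCompactSupport_nonneg_nonzero (x := y0)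
      (φ0.continuous.mul hgc) φ0.hasCompactSupport.mul_right
      (fun y => mul_nonneg φ0.nonneg (hnn y)) ?_
    have : φ0 y0 = 1 := φ0.one_of_mem_closedBall (by simp [φ0])
    rw [this, one_mul]; exact hy0
  let φ : ContDiffBump (0 : EuclideanSpace ℝ (Fin N)) := ⟨1, 2, by norm_num, by norm_num⟩
  have hφd : ContDiff ℝ 1 (φ : EuclideanSpace ℝ (Fin N) → ℝ) := φ.contDiff
  obtain ⟨K, hK⟩ := (φ.hasCompactSupport.fderiv (𝕜 := ℝ)).exists_bound_of_continuous
    (hφd.continuous_fderiv (by simp))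
  have hK0 : 0 ≤ K := (norm_nonneg _).trans (hK 0)
  set ω : ℝ := volume.real (Metric.ball (0 : EuclideanSpace ℝ (Fin N)) 1) with hω
  -- main estimate
  have main : ∀ T : ℝ, 1 ≤ T → ρ ≤ T → ‖y0‖ + 2 ≤ T →
      ∫ y, φ0 y * g y ≤ (N * (K * |C| * 2 ^ N * ω)) / T := by
    intro T hT1 hTρ hT0
    have hTpos : 0 < T := by linarith
    let ψ : EuclideanSpace ℝ (Fin N) → ℝ := fun y => φ (T⁻¹ • y)
    have hψd : ContDiff ℝ 1 ψ := hφd.comp (contDiff_const_smul _)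
    have hψs : HasCompactSupport ψ := φ.hasCompactSupport.comp_smul (inv_ne_zero hTpos.ne')
    have hψf : ∀ y, fderiv ℝ ψ y = T⁻¹ • fderiv ℝ φ (T⁻¹ • y) := by
      intro y
      have h1 : HasFDerivAt (φ : EuclideanSpace ℝ (Fin N) → ℝ) (fderiv ℝ φ (T⁻¹ • y)) (T⁻¹ • y) :=
        ((hφd.differentiable (by simp)) _).hasFDerivAt
      have h2 : HasFDerivAt (fun y : EuclideanSpace ℝ (Fin N) => T⁻¹ • y)
        (T⁻¹ • ContinuousLinearMap.id ℝ _) y := (hasFDerivAt_id (𝕜 := ℝ) y).const_smul T⁻¹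
      have := (h1.comp y h2).fderiv
      change fderiv ℝ ψ y = _ at this
      rw [this]; ext; simp
    have hψin : ∀ y, ‖y‖ < T → fderiv ℝ ψ y = 0 := by
      intro y hy
      rw [hψf]
      have : T⁻¹ • y ∈ Metric.ball (0 : EuclideanSpace ℝ (Fin N)) φ.rIn := by
        simp only [mem_ball_zero_iff, norm_smul, norm_inv, Real.norm_eq_abs, abs_of_pos hTpos, φ]
        rw [inv_mul_lt_iff₀ hTpos]; simpa using hy
      rw [(φ.eventuallyEq_one_of_mem_ball this).fderiv_eq]
      simp
    have hψout : ∀ y, 2 * T ≤ ‖y‖ → ψ y = 0 := by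
      intro y hy
      apply φ.zero_of_le_dist
      simp only [dist_zero_right, norm_smul, norm_inv, Real.norm_eq_abs, abs_of_pos hTpos, φ]
      rw [le_inv_mul_iff₀ hTpos]; linarith
    have hψdout : ∀ y, 2 * T < ‖y‖ → fderiv ℝ ψ y = 0 := by
      intro y hy
      have : ψ =ᶠ[nhds y] fun _ => 0 := by
        filter_upwards [(isOpen_lt continuous_const continuous_norm).mem_nhds hy] with z hz
        exact hψout z (le_of_lt hz)
      rw [this.fderiv_eq]; simp
    have hψc := hψd.continuous_fderiv (by simp)
    have hle : ∫ y, φ0 y * g y ≤ ∫ y, ψ y * g y := by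
      apply integral_mono
      · exact (φ0.continuous.mul hgc).integrable_of_hasCompactSupport φ0.hasCompactSupport.mul_right
      · exact (hψd.continuous.mul hgc).integrable_of_hasCompactSupport hψs.mul_right
      · intro y
        apply mul_le_mul_of_nonneg_right _ (hnn y)
        by_cases hy : ‖y‖ ≤ T
        · have : ψ y = 1 := by
            apply φ.one_of_mem_closedBall
            simp only [mem_closedBall_zero_iff, norm_smul, norm_inv, Real.norm_eq_abs,
              abs_of_pos hTpos, φ]
            rw [inv_mul_le_iff₀ hTpos]; simpa using hy
          rw [this]; exact φ0.le_one
        · have : φ0 y = 0 := φ0.zero_of_le_dist (by simp [φ0]; linarith)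
          rw [this]; exact φ.nonneg
    have hi : ∀ i, Integrable fun y => ψ y * fderiv ℝ (F i) y (EuclideanSpace.single i 1) :=
      fun i => (hψd.continuous.mul (hdFc i)).integrable_of_hasCompactSupport hψs.mul_right
    have hpi : ∀ i, ∫ y, ψ y * fderiv ℝ (F i) y (EuclideanSpace.single i 1) ≤
        (K * |C| * 2 ^ N * ω) / T := by
      intro i
      have hd2 : HasCompactSupport fun y => fderiv ℝ ψ y (EuclideanSpace.single i 1) :=
        hψs.fderiv_apply (𝕜 := ℝ) _
      rw [integral_mul_fderiv_eq_neg_fderiv_mul_of_integrable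
        (((hψc.clm_apply continuous_const).mul (hF i).continuous).integrable_of_hasCompactSupport
          hd2.mul_right) (hi i)
        ((hψd.continuous.mul (hF i).continuous).integrable_of_hasCompactSupport hψs.mul_right)
        (fun x _ => hψd.differentiable (by simp) x)
        (fun x _ => (hF i).differentiable (by simp) x)]
      refine (neg_le_abs _).trans ?_
      rw [← Real.norm_eq_abs]
      have hset : ∫ y, fderiv ℝ ψ y (EuclideanSpace.single i 1) * F i y
          = ∫ y in Metric.closedBall 0 (2 * T),
            fderiv ℝ ψ y (EuclideanSpace.single i 1) * F i y := by
        symm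
        apply setIntegral_eq_integral_of_forall_compl_eq_zero
        intro y hy
        rw [hψdout y (by simpa using hy)]; simp
      rw [hset]
      have hb := norm_setIntegral_le_of_norm_le_const (μ := volume)
        (s := Metric.closedBall (0 : EuclideanSpace ℝ (Fin N)) (2 * T))
        (f := fun y => fderiv ℝ ψ y (EuclideanSpace.single i 1) * F i y)
        (C := T⁻¹ * K * (|C| * (T ^ N)⁻¹)) (isCompact_closedBall _ _).measure_lt_top (by
          intro y _
          by_cases hy : ‖y‖ < T
          · rw [hψin y hy]; simp; positivity
          · push Not at hy
            rw [norm_mul]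
            apply mul_le_mul _ _ (norm_nonneg _) (by positivity)
            · refine (ContinuousLinearMap.le_opNorm _ _).trans ?_
              rw [hψf, norm_smul, norm_inv, Real.norm_eq_abs, abs_of_pos hTpos]
              simp only [PiLp.norm_single, norm_one, mul_one]
              gcongr; exact hK _
            · rw [Real.norm_eq_abs]
              refine (hdec i y (hTρ.trans hy)).trans ?_
              have : C ≤ |C| := le_abs_self C
              gcongr)
      refine hb.trans (le_of_eq ?_)
      have : volume.real (Metric.closedBall (0 : EuclideanSpace ℝ (Fin N)) (2 * T))
          = (2 * T) ^ N * ω := by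
        rw [hω, measureReal_def, measureReal_def,
          Measure.addHaar_closedBall _ _ (by positivity), ENNReal.toReal_mul,
          ENNReal.toReal_ofReal (by positivity)]
        simp
      rw [this]
      rw [mul_pow]; field_simp
    calc _ ≤ _ := hle
      _ = ∑ i, ∫ y, ψ y * fderiv ℝ (F i) y (EuclideanSpace.single i 1) := by
        rw [← integral_finsetSum _ fun i _ => hi i]
        simp only [hg, Finset.mul_sum]
      _ ≤ ∑ i : Fin N, (K * |C| * 2 ^ N * ω) / T := Finset.sum_le_sum fun i _ => hpi i
      _ = _ := by simp; ring
  have hlim : Filter.Tendsto (fun T : ℝ => (N * (K * |C| * 2 ^ N * ω)) / T) Filter.atTop (nhds 0) :=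
    Filter.Tendsto.div_atTop tendsto_const_nhds Filter.tendsto_id
  have : ∫ y, φ0 y * g y ≤ 0 := by
    refine ge_of_tendsto hlim ?_
    filter_upwards [Filter.eventually_ge_atTop 1, Filter.eventually_ge_atTop ρ,
      Filter.eventually_ge_atTop (‖y0‖ + 2)] with T h1 h2 h3 using main T h1 h2 h3
  linarith

lemma aux_calc {N : ℕ} (D : Fin N → EuclideanSpace ℝ (Fin N) → ℝ)
    (V T1 T2 ρ : EuclideanSpace ℝ (Fin N) → ℝ) (y : EuclideanSpace ℝ (Fin N))
    (D' : Fin N → EuclideanSpace ℝ (Fin N) →L[ℝ] ℝ) (V' T1' T2' ρ' : EuclideanSpace ℝ (Fin N) →L[ℝ] ℝ)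
    (hD : ∀ i, HasFDerivAt (D i) (D' i) y) (hV : HasFDerivAt V V' y)
    (hT1 : HasFDerivAt T1 T1' y) (hT2 : HasFDerivAt T2 T2' y) (hρ : HasFDerivAt ρ ρ' y)
    (hDV : ∀ i, V' (EuclideanSpace.single i 1) = D i y)
    (hsymm : ∀ i j, D' i (EuclideanSpace.single j 1) = D' j (EuclideanSpace.single i 1))
    (a b c : ℝ) :
    ∑ i, fderiv ℝ (fun z => D i z * (∑ j, z j * D j z) - z i * (∑ j, D j z ^ 2) / 2
        - a * (z i * T1 z) + b * (ρ z * z i * T2 z) + c * (V z * D i z)) y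
          (EuclideanSpace.single i 1)
      = (∑ i, D' i (EuclideanSpace.single i 1)) * ((∑ j, y j * D j y) + c * V y)
        + (1 - N / 2 + c) * (∑ j, D j y ^ 2)
        - a * (N * T1 y + ∑ j, y j * T1' (EuclideanSpace.single j 1))
        + b * (N * (ρ y * T2 y) + (∑ j, y j * ρ' (EuclideanSpace.single j 1)) * T2 y
            + ρ y * ∑ j, y j * T2' (EuclideanSpace.single j 1)) := by
  have hp : ∀ i : Fin N, HasFDerivAt (fun z : EuclideanSpace ℝ (Fin N) => z i)
      (EuclideanSpace.proj i : EuclideanSpace ℝ (Fin N) →L[ℝ] ℝ) y := fun i =>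
    (EuclideanSpace.proj i : EuclideanSpace ℝ (Fin N) →L[ℝ] ℝ).hasFDerivAt
  have hW := HasFDerivAt.fun_sum (u := Finset.univ) fun j (_ : j ∈ Finset.univ) => (hp j).mul (hD j)
  have hS := HasFDerivAt.fun_sum (u := Finset.univ) fun j (_ : j ∈ Finset.univ) => (hD j).pow 2
  have key : ∀ i, fderiv ℝ (fun z => D i z * (∑ j, z j * D j z) - z i * (∑ j, D j z ^ 2) / 2
        - a * (z i * T1 z) + b * (ρ z * z i * T2 z) + c * (V z * D i z)) y
          (EuclideanSpace.single i 1)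
      = D' i (EuclideanSpace.single i 1) * (∑ j, y j * D j y)
        + D i y * (D i y + ∑ j, y j * D' j (EuclideanSpace.single i 1))
        - ((∑ j, D j y ^ 2) / 2 + y i * ∑ j, D j y * D' j (EuclideanSpace.single i 1))
        - a * (T1 y + y i * T1' (EuclideanSpace.single i 1))
        + b * (ρ y * T2 y + (y i * ρ' (EuclideanSpace.single i 1)) * T2 y
            + ρ y * (y i * T2' (EuclideanSpace.single i 1)))
        + c * (D i y * D i y + V y * D' i (EuclideanSpace.single i 1)) := by
    intro i
    have h := (((((hD i).mul hW).sub (((hp i).mul hS).mul_const (1/2 : ℝ))).sub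
      (((hp i).mul hT1).const_mul a)).add (((hρ.mul (hp i)).mul hT2).const_mul b)).add
      ((hV.mul (hD i)).const_mul c)
    have h2 := h.congr_of_eventuallyEq (f₁ := fun z => D i z * (∑ j, z j * D j z) - z i * (∑ j, D j z ^ 2) / 2
        - a * (z i * T1 z) + b * (ρ z * z i * T2 z) + c * (V z * D i z))
        (Filter.Eventually.of_forall fun z => by
          simp [div_eq_mul_inv])
    rw [h2.fderiv]
    have e1 : ∑ x, D x y * (Pi.single i (1:ℝ) : Fin N → ℝ) x = D i y := by
      simp [Pi.single_apply]
    have e2 : ∑ x, 2 * D x y * D' x (EuclideanSpace.single i 1)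
        = 2 * ∑ x, D x y * D' x (EuclideanSpace.single i 1) := by
      rw [Finset.mul_sum]; exact Finset.sum_congr rfl fun _ _ => by ring
    simp [Finset.sum_add_distrib, hDV, -PiLp.single_apply, e1, e2]
    ring
  rw [Finset.sum_congr rfl fun i _ => key i]
  have hcross : ∑ i, D i y * (∑ j, y j * D' j (EuclideanSpace.single i 1))
      = ∑ i, y i * ∑ j, D j y * D' j (EuclideanSpace.single i 1) := by
    simp only [Finset.mul_sum]
    rw [Finset.sum_comm]
    refine Finset.sum_congr rfl fun i _ => Finset.sum_congr rfl fun j _ => ?_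
    rw [hsymm i j]; ring
  simp only [Finset.sum_add_distrib, Finset.sum_sub_distrib, mul_add, ← Finset.mul_sum,
    ← Finset.sum_mul, hcross, Finset.sum_const, Finset.card_univ, Fintype.card_fin, nsmul_eq_mul]
  simp only [← sq]
  ring

lemma aux_sum {N : ℕ} (ℓ : EuclideanSpace ℝ (Fin N) →L[ℝ] ℝ) (y : EuclideanSpace ℝ (Fin N)) :
    ∑ j, y j * ℓ (EuclideanSpace.single j 1) = ℓ y := by
  conv_rhs => rw [← (EuclideanSpace.basisFun (Fin N) ℝ).sum_repr y]
  simp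

lemma aux_bound (r q B A1 A2 A3 a b c n d w x S T1 X V : ℝ) (hr : 1 ≤ r) (hq0 : 0 ≤ q) (hq1 : q ≤ 1)
    (hrq : r * q ≤ 1) (hB : 0 ≤ B) (hn : 0 ≤ n)
    (hd : |d| ≤ B * q / r) (hw : |w| ≤ B * q) (hx : |x| ≤ r) (hS : |S| ≤ n * (B * q / r) ^ 2)
    (hT1 : |T1| ≤ A1 * q ^ 2) (hX : |X| ≤ A2 * q) (hV : |V| ≤ A3 * q) :
    |d * w - x * S / 2 - a * (x * T1) + b * X + c * (V * d)|
      ≤ (B ^ 2 + n * B ^ 2 + |a| * |A1| + |b| * A2 + |c| * (|A3| * B)) * q := by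
  have hr0 : 0 < r := by linarith
  have hd' : |d| ≤ B * q := hd.trans (div_le_self (by positivity) hr)
  have h1 : |d * w| ≤ B ^ 2 * q := by
    rw [abs_mul]
    calc |d| * |w| ≤ (B * q) * (B * q) := by gcongr
      _ = B ^ 2 * q * q := by ring
      _ ≤ B ^ 2 * q := mul_le_of_le_one_right (by positivity) hq1
  have h2 : |x * S / 2| ≤ n * B ^ 2 * q := by
    rw [abs_div, abs_mul, abs_two]
    have : |x| * |S| ≤ n * B ^ 2 * q := by
      calc |x| * |S| ≤ r * (n * (B * q / r) ^ 2) := by gcongr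
        _ = n * B ^ 2 * q * (q / r) := by field_simp
        _ ≤ n * B ^ 2 * q := mul_le_of_le_one_right (by positivity) ((div_le_self hq0 hr).trans hq1)
    have h0 : 0 ≤ |x| * |S| := by positivity
    linarith
  have h3 : |a * (x * T1)| ≤ |a| * |A1| * q := by
    rw [abs_mul, abs_mul, mul_assoc]
    refine mul_le_mul_of_nonneg_left ?_ (abs_nonneg _)
    calc |x| * |T1| ≤ r * (|A1| * q ^ 2) := by
          gcongr
          exact hT1.trans (by gcongr; exact le_abs_self _)
      _ = |A1| * q * (r * q) := by ring
      _ ≤ |A1| * q := mul_le_of_le_one_right (by positivity) hrq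
  have h4 : |b * X| ≤ |b| * A2 * q := by
    rw [abs_mul, mul_assoc]; gcongr
  have h5 : |c * (V * d)| ≤ |c| * (|A3| * B) * q := by
    rw [abs_mul, abs_mul, mul_assoc]
    refine mul_le_mul_of_nonneg_left ?_ (abs_nonneg _)
    calc |V| * |d| ≤ (|A3| * q) * (B * q) := by
          gcongr
          exact hV.trans (by gcongr; exact le_abs_self _)
      _ = |A3| * B * q * q := by ring
      _ ≤ |A3| * B * q := mul_le_of_le_one_right (by positivity) hq1
  have := abs_add_le (d * w - x * S / 2 - a * (x * T1) + b * X) (c * (V * d))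
  have := abs_add_le (d * w - x * S / 2 - a * (x * T1)) (b * X)
  have := abs_sub (d * w - x * S / 2) (a * (x * T1))
  have := abs_sub (d * w) (x * S / 2)
  linarith

set_option maxHeartbeats 2000000 in
/-- Non-existence. Let `N ≥ 1`, `m > 1`, `σ ≥ σ* = (mN+2)/(m-1)`, and
`m < p ≤ p_F(σ)`. If `v : ℝ^N → [0,∞)` is continuous, `V := v^m` is twice continuously
differentiable, `v` solves the self-similar equation `-ΔV + αv + β y·∇v - |y|^σ v^p = 0`, and
`v` satisfies the decay estimates `v(y) ≤ C₁|y|^{-(σ+2)/(p-m)}`,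
`|∇v(y)| ≤ C₂|y|^{-(σ+2)/(p-m)-1}` for `|y| ≥ R`, then `v ≡ 0`. -/
theorem stmt_16
    (N : ℕ) (hN : 1 ≤ N)
    (m σ p L α β pF : ℝ)
    (hm : 1 < m) (hσ : 0 < σ)
    (hσstar : (m * (N : ℝ) + 2) / (m - 1) ≤ σ)
    (hp : m < p)
    (hL : L = σ * (m - 1) + 2 * (p - 1))
    (hα : α = (σ + 2) / L) (hβ : β = (p - m) / L)
    (hpF : pF = m + (σ + 2) / (N : ℝ)) (hppF : p ≤ pF)
    (v V : EuclideanSpace ℝ (Fin N) → ℝ)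
    (hv : Continuous v) (hv0 : ∀ y, 0 ≤ v y)
    (hV : V = fun y => v y ^ m)
    (hVC2 : ContDiff ℝ 2 V)
    (hPDE : ∀ y : EuclideanSpace ℝ (Fin N),
      -(∑ i, fderiv ℝ (fun z => fderiv ℝ V z (EuclideanSpace.single i 1)) y
          (EuclideanSpace.single i 1))
        + α * v y
        + β * (∑ i, y i * fderiv ℝ v y (EuclideanSpace.single i 1))
        - ‖y‖ ^ σ * v y ^ p = 0)
    (C₁ C₂ R : ℝ) (hC₁ : 0 < C₁) (hC₂ : 0 < C₂) (hR : 0 < R)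
    (hdecay1 : ∀ y : EuclideanSpace ℝ (Fin N), R ≤ ‖y‖ →
      v y ≤ C₁ * ‖y‖ ^ (-(σ + 2) / (p - m)))
    (hdecay2 : ∀ y : EuclideanSpace ℝ (Fin N), R ≤ ‖y‖ →
      ‖fderiv ℝ v y‖ ≤ C₂ * ‖y‖ ^ (-(σ + 2) / (p - m) - 1)) :
    ∀ y : EuclideanSpace ℝ (Fin N), v y = 0 := by
  have hm0 : 0 < m := by linarith
  have hN1 : (1 : ℝ) ≤ N := by exact_mod_cast hN
  have hN0 : (0 : ℝ) < N := by linarith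
  have hpm : 0 < p - m := by linarith
  have hL0 : 0 < L := by
    rw [hL]
    have := mul_pos hσ (sub_pos.2 hm)
    linarith
  have hst : m * N + 2 ≤ σ * (m - 1) := by
    rwa [div_le_iff₀ (by linarith)] at hσstar
  have hσ1 : 1 < σ := by nlinarith
  have hd0 : N * (p - m) ≤ σ + 2 := by
    rw [hpF] at hppF
    have : p - m ≤ (σ + 2) / N := by linarith
    rw [le_div_iff₀ hN0] at this
    linarith
  have hα0 : 0 < α := by rw [hα]; positivity
  have hβ0 : 0 < β := by rw [hβ]; positivity
  -- derivative facts
  have hVy : ∀ y, V y = v y ^ m := fun y => by rw [hV]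
  have hV0 : ∀ y, 0 ≤ V y := fun y => by rw [hVy]; exact Real.rpow_nonneg (hv0 y) _
  have hvV : ∀ y, v y = V y ^ (1 / m) := fun y => by
    rw [hVy, ← Real.rpow_mul (hv0 y), mul_one_div_cancel hm0.ne', Real.rpow_one]
  have hVd : ∀ y, HasFDerivAt V (fderiv ℝ V y) y := fun y =>
    (hVC2.differentiable (by simp) y).hasFDerivAt
  have hVv : ∀ y, fderiv ℝ V y = (m * v y ^ (m - 1)) • fderiv ℝ v y := by
    intro y
    by_cases hy : v y = 0
    · have hmin : IsLocalMin V y := Filter.Eventually.of_forall fun z => by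
        have : V y = 0 := by rw [hVy, hy, Real.zero_rpow hm0.ne']
        rw [this]; exact hV0 z
      rw [hmin.fderiv_eq_zero, hy, Real.zero_rpow (by linarith)]
      simp
    · have hvd : DifferentiableAt ℝ v y := by
        have h1 : v = fun y => V y ^ (1 / m) := funext hvV
        rw [h1]
        have hVne : V y ≠ 0 := by
          rw [hVy]; exact (Real.rpow_pos_of_pos (lt_of_le_of_ne (hv0 y) (Ne.symm hy)) _).ne'
        exact ((hVd y).rpow_const (Or.inl hVne)).differentiableAt
      have h2 := hvd.hasFDerivAt.rpow_const (p := m) (Or.inl hy)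
      rw [← hV] at h2
      exact h2.fderiv
  have hpow : ∀ s : ℝ, 0 ≤ s → ∀ y, v y ^ (m + s) = V y ^ (1 + s / m) := by
    intro s hs y
    rw [hVy, ← Real.rpow_mul (hv0 y)]
    congr 1; field_simp
  have hTd : ∀ s : ℝ, 0 ≤ s → ∀ y, HasFDerivAt (fun y => v y ^ (m + s))
      (((m + s) / m * v y ^ s) • fderiv ℝ V y) y := by
    intro s hs y
    have h1 := (hVd y).rpow_const (p := 1 + s / m) (Or.inr (by
      have : 0 ≤ s / m := by positivity
      linarith))
    have h2 : (fun y => v y ^ (m + s)) = fun y => V y ^ (1 + s / m) := funext (hpow s hs)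
    rw [h2]
    have h3 : (m + s) / m * v y ^ s = (1 + s / m) * V y ^ (1 + s / m - 1) := by
      rw [hVy, ← Real.rpow_mul (hv0 y)]
      have e1 : m * (1 + s / m - 1) = s := by field_simp; ring
      have e2 : (m + s) / m = 1 + s / m := by field_simp
      rw [e1, e2]
    rw [h3]
    exact h1
  have hTc : ∀ s : ℝ, 0 ≤ s → ContDiff ℝ 1 (fun y => v y ^ (m + s)) := by
    intro s hs
    have h2 : (fun y => v y ^ (m + s)) = fun y => V y ^ (1 + s / m) := funext (hpow s hs)
    rw [h2]
    have := ContDiff.rpow_const_of_le (m := 1) (p := 1 + s / m) (hVC2.of_le (by norm_num))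
      (by have : 0 ≤ s / m := by positivity
          push_cast; linarith)
    simpa using this
  let e : Fin N → EuclideanSpace ℝ (Fin N) := fun i => EuclideanSpace.single i 1
  let D : Fin N → EuclideanSpace ℝ (Fin N) → ℝ := fun i z => fderiv ℝ V z (e i)
  have hfd : ContDiff ℝ 1 (fderiv ℝ V) := hVC2.fderiv_right (by norm_num)
  have hDc : ∀ i, ContDiff ℝ 1 (D i) := fun i => hfd.clm_apply contDiff_const
  have hDd : ∀ i y, HasFDerivAt (D i) (fderiv ℝ (D i) y) y := fun i y =>
    ((hDc i).differentiable (by simp) y).hasFDerivAt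
  have hsymm : ∀ y i j, fderiv ℝ (D i) y (e j) = fderiv ℝ (D j) y (e i) := by
    intro y i j
    have h1 : HasFDerivAt (fderiv ℝ V) (fderiv ℝ (fderiv ℝ V) y) y :=
      (hfd.differentiable (by simp) y).hasFDerivAt
    have h2 : ∀ i j, fderiv ℝ (D i) y (e j) = fderiv ℝ (fderiv ℝ V) y (e j) (e i) := by
      intro i j
      have := (h1.clm_apply (hasFDerivAt_const (e i) y)).fderiv
      change fderiv ℝ (D i) y = _ at this
      rw [this]; simp
    rw [h2, h2]
    exact second_derivative_symmetric hVd h1 _ _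
  -- constants
  set c : ℝ := (N + σ) * m / (m + p) with hc
  set b : ℝ := m / (m + p) with hb
  set a : ℝ := (α * m + c * β) / (m + 1) with ha
  have hmp : 0 < m + p := by linarith
  have hc0 : 0 < c := by rw [hc]; positivity
  have hcA : 0 < 1 - N / 2 + c := by
    have h1 : (1 - N / 2 + c) * (2 * (m + p)) = (2 - N) * (m + p) + 2 * m * (N + σ) := by
      rw [hc]; field_simp
    have h2 : 0 < (2 - N) * (m + p) + 2 * m * (N + σ) := by nlinarith
    rw [← h1] at h2
    exact pos_of_mul_pos_left h2 (by positivity)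
  have hcB : 0 ≤ c * α - a * N := by
    have h1 : (c * α - a * N) * (L * (m + 1) * (m + p)) =
        m * ((N + σ) * ((σ + 2) * (m + 1) - N * (p - m)) - N * (σ + 2) * (m + p)) := by
      rw [ha, hc, hα, hβ]; field_simp; ring
    have h2 : 0 ≤ (N + σ) * ((σ + 2) * (m + 1) - N * (p - m)) - N * (σ + 2) * (m + p) := by
      have h3 : 0 ≤ (σ + 2) * (σ * (m - 1) - (m * N + 2)) :=
        mul_nonneg (by linarith) (by linarith)
      have h4 : 0 ≤ (σ + 2 - N * (p - m)) * (N + 2 * σ + 2) :=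
        mul_nonneg (by linarith) (by linarith)
      linarith
    have h3 := mul_nonneg hm0.le h2
    rw [← h1] at h3
    exact nonneg_of_mul_nonneg_left h3 (by positivity)
  let F : Fin N → EuclideanSpace ℝ (Fin N) → ℝ := fun i z =>
    D i z * (∑ j, z j * D j z) - z i * (∑ j, D j z ^ 2) / 2
        - a * (z i * v z ^ (m + 1)) + b * (‖z‖ ^ σ * z i * v z ^ (m + p)) + c * (V z * D i z)
  have hpc : ∀ i : Fin N, ContDiff ℝ 1 (fun z : EuclideanSpace ℝ (Fin N) => z i) := fun i =>
    (EuclideanSpace.proj i : EuclideanSpace ℝ (Fin N) →L[ℝ] ℝ).contDiff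
  have hFc : ∀ i, ContDiff ℝ 1 (F i) := by
    intro i
    have hW : ContDiff ℝ 1 fun z : EuclideanSpace ℝ (Fin N) => ∑ j, z j * D j z :=
      ContDiff.sum fun j _ => (hpc j).mul (hDc j)
    have hS : ContDiff ℝ 1 fun z : EuclideanSpace ℝ (Fin N) => ∑ j, D j z ^ 2 :=
      ContDiff.sum fun j _ => (hDc j).pow 2
    have hρ : ContDiff ℝ 1 fun z : EuclideanSpace ℝ (Fin N) => ‖z‖ ^ σ := contDiff_norm_rpow hσ1
    exact (((((hDc i).mul hW).sub (((hpc i).mul hS).div_const 2)).sub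
      (contDiff_const.mul ((hpc i).mul (hTc 1 (by norm_num))))).add
      (contDiff_const.mul ((hρ.mul (hpc i)).mul (hTc p (by linarith))))).add
      (contDiff_const.mul ((hVC2.of_le (by norm_num)).mul (hDc i)))
  have hdiv : ∀ y, ∃ X : ℝ, 0 ≤ X ∧ ∑ i, fderiv ℝ (F i) y (EuclideanSpace.single i 1) =
      (1 - N / 2 + c) * (∑ j, D j y ^ 2) + X := by
    intro y
    refine ⟨(c * α - a * N) * v y ^ (m + 1) + β * (m * v y ^ (m - 1)) *
      (∑ i, y i * fderiv ℝ v y (EuclideanSpace.single i 1)) ^ 2, ?_, ?_⟩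
    · have := Real.rpow_nonneg (hv0 y) (m + 1)
      have := Real.rpow_nonneg (hv0 y) (m - 1)
      positivity
    · have h := aux_calc D V (fun y => v y ^ (m + 1)) (fun y => v y ^ (m + p)) (fun y => ‖y‖ ^ σ) y
        (fun i => fderiv ℝ (D i) y) _ _ _ _ (fun i => hDd i y) (hVd y) (hTd 1 (by norm_num) y)
        (hTd p (by linarith) y) (hasFDerivAt_norm_rpow y hσ1) (fun i => rfl)
        (fun i j => hsymm y i j) a b c
      refine h.trans ?_
      have hP := hPDE y
      rw [aux_sum (fderiv ℝ v y)] at hP ⊢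
      have hW : ∑ j, y j * D j y = fderiv ℝ V y y := aux_sum (fderiv ℝ V y) y
      rw [hW, aux_sum, aux_sum, aux_sum]
      have hWZ : fderiv ℝ V y y = m * v y ^ (m - 1) * fderiv ℝ v y y := by
        rw [hVv]; simp
      have hP' : ∑ i, fderiv ℝ (D i) y (EuclideanSpace.single i 1)
          = α * v y + β * fderiv ℝ v y y - ‖y‖ ^ σ * v y ^ p := by
        have : ∑ i, fderiv ℝ (D i) y (EuclideanSpace.single i 1) =
          ∑ i, fderiv ℝ (fun z => fderiv ℝ V z (EuclideanSpace.single i 1)) y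
          (EuclideanSpace.single i 1) := rfl
        linarith
      rw [hP']
      have hρ : ((σ * ‖y‖ ^ (σ - 2)) • innerSL ℝ y) y = σ * ‖y‖ ^ σ := by
        simp only [ContinuousLinearMap.smul_apply, innerSL_apply_apply, real_inner_self_eq_norm_sq,
          smul_eq_mul]
        rw [mul_assoc]; congr 1
        rcases eq_or_ne ‖y‖ 0 with h0 | h0
        · rw [h0, Real.zero_rpow hσ.ne']; simp
        · rw [← Real.rpow_natCast, ← Real.rpow_add (lt_of_le_of_ne (norm_nonneg y) h0.symm)]
          congr 1; push_cast; ring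
      rw [hρ]
      simp only [ContinuousLinearMap.smul_apply, smul_eq_mul, Real.rpow_one]
      have hT1 : v y ^ (m + 1) = v y * V y := by
        rw [Real.rpow_add_of_nonneg (hv0 y) hm0.le (by norm_num), Real.rpow_one, ← hVy]; ring
      have hT2 : v y ^ (m + p) = v y ^ p * V y := by
        rw [Real.rpow_add_of_nonneg (hv0 y) hm0.le (by linarith), ← hVy]; ring
      have hVm : V y = v y ^ (m - 1) * v y := by
        have := Real.rpow_add_of_nonneg (hv0 y) (y := m - 1) (z := 1) (by linarith) (by norm_num)
        rw [Real.rpow_one, sub_add_cancel] at this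
        rw [hVy, this]
      rw [hT1, hT2, hWZ, hVm, ha, hb, hc]
      field_simp
      ring
  -- decay
  set k : ℝ := (σ + 2) / (p - m) with hk
  have hkN : (N : ℝ) ≤ k := by rw [hk, le_div_iff₀ hpm]; exact hd0
  have hk0 : 0 < k := by linarith
  have hneg : -(σ + 2) / (p - m) = -k := by rw [hk]; ring
  rw [hneg] at hdecay1 hdecay2
  set B : ℝ := m * C₁ ^ (m - 1) * C₂ with hB
  have hB0 : 0 ≤ B := by positivity
  have hdecF : ∀ i y, max R 1 ≤ ‖y‖ → |F i y| ≤
      (B ^ 2 + N * B ^ 2 + |a| * |C₁ ^ (m + 1)| + |b| * C₁ ^ (m + p) + |c| * (|C₁ ^ m| * B))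
        * (‖y‖ ^ N)⁻¹ := by
    intro i y hy
    have hRy : R ≤ ‖y‖ := (le_max_left _ _).trans hy
    have hr : 1 ≤ ‖y‖ := (le_max_right _ _).trans hy
    have hv1 := hdecay1 y hRy
    have hv2 := hdecay2 y hRy
    have hvy := hv0 y
    set r := ‖y‖ with hrdef
    have hr0 : 0 < r := by linarith
    rw [Real.rpow_sub_one hr0.ne'] at hv2
    set q : ℝ := r ^ (-k) with hq
    have hq0 : 0 < q := Real.rpow_pos_of_pos hr0 _
    have hqN : q ≤ (r ^ N)⁻¹ := by
      rw [hq, ← Real.rpow_natCast, ← Real.rpow_neg hr0.le]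
      exact Real.rpow_le_rpow_of_exponent_le hr (by linarith)
    have hqr : q ≤ r⁻¹ := by
      rw [hq, ← Real.rpow_neg_one]
      exact Real.rpow_le_rpow_of_exponent_le hr (by linarith)
    have hrq : r * q ≤ 1 := by
      calc r * q ≤ r * r⁻¹ := by gcongr
        _ = 1 := mul_inv_cancel₀ hr0.ne'
    have hq1 : q ≤ 1 := hqr.trans (inv_le_one_of_one_le₀ hr)
    have hqs : ∀ s : ℝ, 1 ≤ s → q ^ s ≤ q := fun s hs => by
      simpa using Real.rpow_le_rpow_of_exponent_ge hq0 hq1 hs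
    have hvs : ∀ s : ℝ, 0 ≤ s → v y ^ s ≤ C₁ ^ s * q ^ s := fun s hs => by
      rw [← Real.mul_rpow hC₁.le hq0.le]
      exact Real.rpow_le_rpow hvy hv1 hs
    have hVf : ‖fderiv ℝ V y‖ ≤ B * q / r := by
      rw [hVv, norm_smul, Real.norm_eq_abs, abs_of_nonneg (by positivity)]
      calc m * v y ^ (m - 1) * ‖fderiv ℝ v y‖
          ≤ m * (C₁ ^ (m - 1) * q ^ (m - 1)) * (C₂ * (q / r)) := by
            gcongr; exact hvs _ (by linarith)
        _ = B * (q ^ (m - 1) * q) / r := by rw [hB]; ring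
        _ ≤ B * q / r := by
            gcongr
            rw [← Real.rpow_add_one hq0.ne', sub_add_cancel]
            exact hqs m hm.le
    have hDb : ∀ j, |D j y| ≤ B * q / r := fun j => by
      rw [← Real.norm_eq_abs]
      refine ((fderiv ℝ V y).le_opNorm _).trans ?_
      simpa [e] using hVf
    have hqq := aux_bound r q B (C₁ ^ (m + 1)) (C₁ ^ (m + p)) (C₁ ^ m) a b c N (D i y)
      (∑ j, y j * D j y) (y i) (∑ j, D j y ^ 2) (v y ^ (m + 1)) (r ^ σ * y i * v y ^ (m + p)) (V y)
      hr hq0.le hq1 hrq hB0 hN0.le (hDb i) ?_ ?_ ?_ ?_ ?_ ?_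
    · refine hqq.trans ?_
      gcongr
    · have hW : ∑ j, y j * D j y = fderiv ℝ V y y := aux_sum (fderiv ℝ V y) y
      rw [hW, ← Real.norm_eq_abs]
      refine ((fderiv ℝ V y).le_opNorm _).trans ?_
      calc ‖fderiv ℝ V y‖ * ‖y‖ ≤ B * q / r * r := by rw [← hrdef]; gcongr
        _ = B * q := by field_simp
    · rw [← Real.norm_eq_abs]; exact PiLp.norm_apply_le y i
    · rw [abs_of_nonneg (Finset.sum_nonneg fun _ _ => sq_nonneg _)]
      calc ∑ j, D j y ^ 2 ≤ ∑ j : Fin N, (B * q / r) ^ 2 :=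
            Finset.sum_le_sum fun j _ => by
              rw [← sq_abs]; exact pow_le_pow_left₀ (abs_nonneg _) (hDb j) 2
        _ = _ := by simp
    · rw [abs_of_nonneg (by positivity)]
      refine (hvs _ (by linarith)).trans ?_
      gcongr
      rw [← Real.rpow_natCast]
      exact Real.rpow_le_rpow_of_exponent_ge hq0 hq1 (by push_cast; linarith)
    · have hyi : |y i| ≤ r := by rw [← Real.norm_eq_abs]; exact PiLp.norm_apply_le y i
      rw [abs_mul, abs_mul, abs_of_nonneg (by positivity : 0 ≤ r ^ σ),
        abs_of_nonneg (by positivity : 0 ≤ v y ^ (m + p))]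
      have hqpm : q ^ (p - m) = r ^ (-(σ + 2)) := by
        rw [hq, ← Real.rpow_mul hr0.le, hk]
        congr 1; field_simp
      have hrr : r ^ σ * r * q ^ (p - m) ≤ 1 := by
        rw [hqpm, ← Real.rpow_add_one hr0.ne', ← Real.rpow_add hr0]
        exact Real.rpow_le_one_of_one_le_of_nonpos hr (by linarith)
      calc r ^ σ * |y i| * v y ^ (m + p) ≤ r ^ σ * r * (C₁ ^ (m + p) * q ^ (m + p)) := by
            gcongr; exact hvs _ (by linarith)
        _ = C₁ ^ (m + p) * (q ^ (2 * m) * (r ^ σ * r * q ^ (p - m))) := by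
            have : m + p = 2 * m + (p - m) := by ring
            have h2 : q ^ (m + p) = q ^ (2 * m) * q ^ (p - m) := by
              rw [this, Real.rpow_add hq0]
            rw [h2]; ring
        _ ≤ C₁ ^ (m + p) * (q * 1) := by
            gcongr
            exact hqs _ (by linarith)
        _ = _ := by ring
    · rw [abs_of_nonneg (hV0 y), hVy]
      refine (hvs _ hm0.le).trans ?_
      gcongr
      exact hqs m hm.le
  have hzero := aux_div F hFc _ _ hdecF (fun y => by
    obtain ⟨X, hX, h⟩ := hdiv y
    rw [h]
    have : 0 ≤ ∑ j, D j y ^ 2 := Finset.sum_nonneg fun _ _ => sq_nonneg _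
    positivity)
  have hV' : ∀ y, fderiv ℝ V y = 0 := by
    intro y
    obtain ⟨X, hX, h⟩ := hdiv y
    rw [hzero y] at h
    have hS0 : 0 ≤ ∑ j, D j y ^ 2 := Finset.sum_nonneg fun _ _ => sq_nonneg _
    have hS : ∑ j, D j y ^ 2 = 0 := by
      have := mul_nonneg hcA.le hS0
      have h3 : (1 - N / 2 + c) * (∑ j, D j y ^ 2) = 0 := by linarith
      exact (mul_eq_zero.1 h3).resolve_left hcA.ne'
    rw [Finset.sum_eq_zero_iff_of_nonneg (fun _ _ => sq_nonneg _)] at hS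
    ext z
    rw [← aux_sum]
    simp only [zero_apply]
    refine Finset.sum_eq_zero fun j hj => ?_
    have : D j y = 0 := pow_eq_zero_iff (two_ne_zero) |>.1 (hS j hj)
    change z j * D j y = 0
    rw [this, mul_zero]
  have hconst : ∀ x y, v x = v y := fun x y => by
    rw [hvV, hvV y, is_const_of_fderiv_eq_zero (hVC2.differentiable (by simp)) hV' x y]
  intro y
  refine le_antisymm ?_ (hv0 y)
  have hlim : Filter.Tendsto (fun T : ℝ => C₁ * T ^ (-k)) Filter.atTop (nhds 0) := by
    simpa using (tendsto_rpow_neg_atTop hk0).const_mul C₁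
  refine ge_of_tendsto hlim ?_
  filter_upwards [Filter.eventually_ge_atTop R] with T hT
  have hT0 : 0 ≤ T := hR.le.trans hT
  have hn : ‖(EuclideanSpace.single (⟨0, hN⟩ : Fin N) T : EuclideanSpace ℝ (Fin N))‖ = T := by
    rw [PiLp.norm_single, Real.norm_eq_abs, abs_of_nonneg hT0]
  have := hdecay1 (EuclideanSpace.single ⟨0, hN⟩ T) (by rw [hn]; exact hT)
  rw [hn] at this
  rw [hconst y]; exact this
end

section
/- For the system (S) with σ > 0, at every point of the plane Z = (N+σ)(X/N - Y) with Y > 0, the inner product of the vector field of (S) with the normal vector n̄ = (1/N)(-(N+σ), N(N+σ), N) equals F₁(X,Y) = -p(N+σ)·Y·[Y - ((p-m)(N+σ)+L)·X/(N·p·(σ+2))]. Moreover, if p > p_F(σ) = m + (σ+2)/N, Y > 0 and Y ≤ X/N (the latter being equivalent to Z ≥ 0 on the plane), then F₁(X,Y) > 0. -/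
/-- For the system (S) with `σ > 0`, on the plane `Z = (N+σ)(X/N - Y)` with
`Y > 0`, the inner product of the vector field with the normal
`n̄ = (1/N)(-(N+σ), N(N+σ), N)` equals
`F₁(X,Y) = -p(N+σ)·Y·[Y - ((p-m)(N+σ)+L)X/(Np(σ+2))]`. Moreover, `Z ≥ 0` on the plane is
equivalent to `Y ≤ X/N`, and if `p > p_F(σ)`, `Y > 0` and `Y ≤ X/N`, then `F₁(X,Y) > 0`. -/
theorem stmt_18
    (N : ℕ) (hN : 3 ≤ N)
    (m σ p L pF : ℝ)
    (hm : 1 < m) (hσ : 0 < σ) (hp : m < p)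
    (hL : L = σ * (m - 1) + 2 * (p - 1))
    (hpF : pF = m + (σ + 2) / (N : ℝ)) :
    ∀ X Y Z F₁ : ℝ,
      Z = ((N : ℝ) + σ) * (X / (N : ℝ) - Y) → 0 < Y →
      F₁ = -p * ((N : ℝ) + σ) * Y
          * (Y - ((p - m) * ((N : ℝ) + σ) + L) * X / ((N : ℝ) * p * (σ + 2))) →
      ((1 / (N : ℝ)) * (-((N : ℝ) + σ)) * (X * (2 - (m - 1) * Y))
          + (1 / (N : ℝ)) * ((N : ℝ) * ((N : ℝ) + σ))
            * (X - ((N : ℝ) - 2) * Y - Z - m * Y ^ 2 + (p - m) / (σ + 2) * (X * Y))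
          + (1 / (N : ℝ)) * (N : ℝ) * (Z * (σ + 2 + (p - m) * Y)) = F₁)
      ∧ (0 ≤ Z ↔ Y ≤ X / (N : ℝ))
      ∧ (pF < p → Y ≤ X / (N : ℝ) → 0 < F₁) := by
  intro X Y Z F₁ hZ hY hF
  have hN0 : (0 : ℝ) < N := by
    have : 0 < N := by omega
    exact_mod_cast this
  have hp0 : 0 < p := by linarith
  have hs : 0 < σ + 2 := by linarith
  have hNs : 0 < (N : ℝ) + σ := by linarith
  refine ⟨?_, ?_, ?_⟩
  · rw [hF, hZ, hL]
    field_simp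
    ring
  · rw [hZ, mul_nonneg_iff_of_pos_left hNs, sub_nonneg]
  · intro h1 h2
    rw [hpF] at h1
    have h3 : σ + 2 < (p - m) * N := by
      rw [← div_lt_iff₀ hN0]
      linarith
    have hX : 0 < X / (N : ℝ) := by linarith
    have e : ((p - m) * ((N : ℝ) + σ) + L) * X / ((N : ℝ) * p * (σ + 2))
        = X / N + X / N * (((p - m) * N - (σ + 2)) / (p * (σ + 2))) := by
      rw [hL]
      field_simp
      ring
    have h4 : 0 < X / (N : ℝ) * (((p - m) * N - (σ + 2)) / (p * (σ + 2))) :=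
      mul_pos hX (div_pos (by linarith) (mul_pos hp0 hs))
    have h5 : 0 < p * ((N : ℝ) + σ) * Y := by positivity
    rw [hF, e]
    have h6 := mul_pos h5 (show 0 < X / (N : ℝ) + X / (N : ℝ) * (((p - m) * N - (σ + 2)) / (p * (σ + 2))) - Y by linarith)
    linarith
end

section
/- For the system (S) with σ > 0, at every point of the surface Z = (N+σ)(X/N - Y) - pY² + ((p-m)(N+σ)/(N(σ+2)))XY with Y ≤ 0, the inner product of the vector field of (S) with the normal vector N̄ = (-(N+σ)(σ+2+(p-m)Y)/(N(σ+2)), -((p-m)(N+σ)/(N(σ+2)))X + 2pY + (N+σ), 1) equals F₂(X,Y) = (Y + (σ+2)/(p-m))·[(σ(p-m)²(N+σ)/(N²(σ+2)²))X² + ((p-m)·C/(N(σ+2)))·XY + (p-m)p·Y²], where C = (N+σ)(m-1) - 2pσ. Moreover, if p > (N+σ)(m-1)/(2σ) (so that C < 0), X > 0 and -(σ+2)/(p-m) < Y < 0, then F₂(X,Y) > 0. -/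
/-- For the system (S) with `σ > 0`, on the surface
`Z = (N+σ)(X/N - Y) - pY² + ((p-m)(N+σ)/(N(σ+2)))XY` with `Y ≤ 0`, the inner product of the
vector field with the normal
`N̄ = (-(N+σ)(σ+2+(p-m)Y)/(N(σ+2)), -((p-m)(N+σ)/(N(σ+2)))X + 2pY + (N+σ), 1)` equals
`F₂(X,Y) = (Y + (σ+2)/(p-m))·[(σ(p-m)²(N+σ)/(N²(σ+2)²))X² + ((p-m)C/(N(σ+2)))XY + (p-m)pY²]`,
with `C = (N+σ)(m-1) - 2pσ`. Moreover, if `p > (N+σ)(m-1)/(2σ)` then `C < 0`, and if in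
addition `X > 0` and `-(σ+2)/(p-m) < Y < 0`, then `F₂(X,Y) > 0`. -/
theorem stmt_19
    (N : ℕ) (hN : 3 ≤ N)
    (m σ p Cc : ℝ)
    (hm : 1 < m) (hσ : 0 < σ) (hp : m < p)
    (hCc : Cc = ((N : ℝ) + σ) * (m - 1) - 2 * p * σ) :
    ∀ X Y Z F₂ : ℝ, Y ≤ 0 →
      Z = ((N : ℝ) + σ) * (X / (N : ℝ) - Y) - p * Y ^ 2
          + (p - m) * ((N : ℝ) + σ) / ((N : ℝ) * (σ + 2)) * (X * Y) →
      F₂ = (Y + (σ + 2) / (p - m))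
          * (σ * (p - m) ^ 2 * ((N : ℝ) + σ) / ((N : ℝ) ^ 2 * (σ + 2) ^ 2) * X ^ 2
            + (p - m) * Cc / ((N : ℝ) * (σ + 2)) * (X * Y)
            + (p - m) * p * Y ^ 2) →
      ((-(((N : ℝ) + σ) * (σ + 2 + (p - m) * Y)) / ((N : ℝ) * (σ + 2)))
            * (X * (2 - (m - 1) * Y))
          + (-((p - m) * ((N : ℝ) + σ) / ((N : ℝ) * (σ + 2))) * X + 2 * p * Y + ((N : ℝ) + σ))
            * (X - ((N : ℝ) - 2) * Y - Z - m * Y ^ 2 + (p - m) / (σ + 2) * (X * Y))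
          + 1 * (Z * (σ + 2 + (p - m) * Y)) = F₂)
      ∧ (((N : ℝ) + σ) * (m - 1) / (2 * σ) < p → Cc < 0)
      ∧ (((N : ℝ) + σ) * (m - 1) / (2 * σ) < p → 0 < X → -(σ + 2) / (p - m) < Y → Y < 0 →
          0 < F₂) := by
  have hN0 : (0:ℝ) < N := by
    have : (3:ℝ) ≤ N := by exact_mod_cast hN
    linarith
  have hs : 0 < σ + 2 := by linarith
  have hpm : 0 < p - m := by linarith
  have hC : ((N : ℝ) + σ) * (m - 1) / (2 * σ) < p → Cc < 0 := by
    intro h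
    rw [div_lt_iff₀ (by linarith)] at h
    rw [hCc]; linarith
  intro X Y Z F hY hZ hF
  refine ⟨?_, hC, ?_⟩
  · rw [hF, hZ, hCc]
    have h1 := hN0.ne'
    have h2 := hs.ne'
    have h3 := hpm.ne'
    field_simp
    ring
  · intro h hX hY1 hY2
    have hc := hC h
    have hp0 : 0 < p := by linarith
    rw [hF]
    apply mul_pos
    · rw [neg_div] at hY1; linarith
    · have hXY : 0 < (p - m) * (-Cc) / ((N : ℝ) * (σ + 2)) * (X * (-Y)) := by
        have : 0 < -Cc := by linarith
        have : 0 < -Y := by linarith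
        positivity
      have e : (p - m) * Cc / ((N : ℝ) * (σ + 2)) * (X * Y)
          = (p - m) * (-Cc) / ((N : ℝ) * (σ + 2)) * (X * (-Y)) := by ring
      rw [e]
      positivity
end
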